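/- arXiv:2302.06257 — 6 statements merged into one kernel-verified Lean document; each statement's English description precedes it below -/
import Mathlib

section
/- Let G be a non-abelian finite p-group and let χ be a faithful irreducible complex character of G. If the character degree set of G is {1, p, p^a} for some integer a > 1, then χ(1) = p^a. -/
open FDRep CategoryTheory Subgroup

/-- The minimal faithful permutation degree of `G`. -/
noncomputable def permDegree (G : Type*) [Group G] : ℕ :=
  sInf {n | ∃ f : G →* Equiv.Perm (Fin n), Function.Injective f}

/-- The minimal degree of a faithful quasi-permutation representation of `G` over `ℂ`:
a faithful matrix representation in which every element has non-negative integral trace. -/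
noncomputable def quasiPermDegree (G : Type*) [Group G] : ℕ :=
  sInf {n | ∃ ρ : G →* Matrix.GeneralLinearGroup (Fin n) ℂ,
    Function.Injective ρ ∧ ∀ g : G, ∃ m : ℕ, Matrix.trace ((ρ g : Matrix (Fin n) (Fin n) ℂ)) = (m : ℂ)}

/-- The set of degrees of irreducible complex characters of `G`. -/
def cdSet (G : Type) [Group G] : Set ℕ :=
  {n | ∃ V : FDRep ℂ G, Simple V ∧ Module.finrank ℂ V = n}

/-- The minimal number of generators of `G`. -/
noncomputable def minGens (G : Type*) [Group G] : ℕ :=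
  sInf {n | ∃ S : Finset G, S.card = n ∧ Subgroup.closure (S : Set G) = ⊤}

theorem FDRep.isIrreducible_of_simple {k G : Type} [Field k] [Monoid G] (V : FDRep k G)
    [Simple V] : Representation.IsIrreducible V.ρ := by
  have hsub (U : Subrepresentation V.ρ) : U = ⊥ ∨ U = ⊤ := by
    let ι : FDRep.of U.toRepresentation ⟶ V :=
      ⟨FGModuleCat.ofHom U.toSubmodule.subtype, fun g => by ext x; rfl⟩
    have hmono : Mono ι := by
      apply (Action.forget (FGModuleCat k) G).mono_of_mono_map
      apply (forget₂ (FGModuleCat k) (ModuleCat k)).mono_of_mono_map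
      exact (ModuleCat.mono_iff_injective _).mpr U.toSubmodule.injective_subtype
    by_cases h : ι = 0
    · left
      apply Subrepresentation.toSubmodule_injective
      refine (Submodule.eq_bot_iff _).mpr fun x hx => ?_
      exact congrArg (fun f : FDRep.of U.toRepresentation ⟶ V => f.hom.hom.hom ⟨x, hx⟩) h
    · right
      have hiso : IsIso ι := isIso_of_mono_of_nonzero h
      apply Subrepresentation.toSubmodule_injective
      refine (Submodule.eq_top_iff').mpr fun x => ?_
      have hx := congrArg (fun f : V ⟶ V => f.hom.hom.hom x) (IsIso.inv_hom_id ι)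
      change ((inv ι).hom.hom.hom x : U.toSubmodule).1 = x at hx
      rw [← hx]
      exact Subtype.property _
  have hnt : Nontrivial V := by
    by_contra h
    rw [not_nontrivial_iff_subsingleton] at h
    refine id_nonzero V ?_
    ext x
    exact Subsingleton.elim (α := V) _ _
  have : Nontrivial (Subrepresentation V.ρ) := by
    refine ⟨⊥, ⊤, fun h => ?_⟩
    have h' : (⊥ : Submodule k V) = ⊤ := congrArg Subrepresentation.toSubmodule h
    exact bot_ne_top h'
  exact ⟨hsub⟩

theorem Representation.IsIrreducible.exists_smul_of_mem_center {k G W : Type*} [Field k]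
    [IsAlgClosed k] [Group G] [AddCommGroup W] [Module k W] [FiniteDimensional k W]
    (ρ : Representation k G W) [ρ.IsIrreducible] {z : G} (hz : z ∈ center G) :
    ∃ c : k, ∀ w, ρ z w = c • w := by
  have : Nontrivial W := by
    by_contra h
    rw [not_nontrivial_iff_subsingleton] at h
    exact bot_ne_top (α := Subrepresentation ρ)
      (Subrepresentation.toSubmodule_injective (Subsingleton.elim _ _))
  obtain ⟨c, hc⟩ := Module.End.exists_eigenvalue (ρ z)
  obtain ⟨v, hv⟩ := hc.exists_hasEigenvector
  let U : Subrepresentation ρ := ⟨Module.End.eigenspace (ρ z) c, fun g w hw => by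
    rw [Module.End.mem_eigenspace_iff] at hw ⊢
    rw [← Module.End.mul_apply, ← map_mul, ← mem_center_iff.mp hz g, map_mul,
      Module.End.mul_apply, hw, map_smul]⟩
  have hU : U = ⊤ := (eq_bot_or_eq_top U).resolve_left fun h =>
    hv.2 ((Submodule.eq_bot_iff _).mp (congrArg Subrepresentation.toSubmodule h) v hv.1)
  refine ⟨c, fun w => Module.End.mem_eigenspace_iff.mp ?_⟩
  exact (Submodule.eq_top_iff'.mp (congrArg Subrepresentation.toSubmodule hU)) w

theorem Module.End.exists_common_eigenvector_of_commute {k W ι : Type*} [Field k] [IsAlgClosed k]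
    [AddCommGroup W] [Module k W] [FiniteDimensional k W] [Nontrivial W] (f : ι → Module.End k W)
    (hf : ∀ i j, Commute (f i) (f j)) :
    ∃ v : W, v ≠ 0 ∧ ∀ i, ∃ c : k, f i v = c • v := by
  let S : Set (Submodule k W) := {U | U ≠ ⊥ ∧ ∀ i, ∀ w ∈ U, f i w ∈ U}
  obtain ⟨U, ⟨hU, hinv⟩, hmin⟩ := wellFounded_lt.has_min S ⟨⊤, top_ne_bot, by simp⟩
  obtain ⟨v, hvU, hv⟩ := U.exists_mem_ne_zero_of_ne_bot hU
  refine ⟨v, hv, fun i => ?_⟩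
  have : Nontrivial U := ⟨⟨⟨v, hvU⟩, 0, fun h => hv (congrArg Subtype.val h)⟩⟩
  obtain ⟨c, hc⟩ := Module.End.exists_eigenvalue ((f i).restrict (hinv i))
  obtain ⟨⟨u, huU⟩, hu⟩ := hc.exists_hasEigenvector
  have hfu : f i u = c • u := congrArg Subtype.val hu.apply_eq_smul
  refine ⟨c, ?_⟩
  by_contra hvc
  refine hmin (U ⊓ Module.End.eigenspace (f i) c) ⟨fun h => hu.2 (Subtype.ext ?_), ?_⟩
    (lt_of_le_of_ne inf_le_left fun h => hvc ?_)
  · exact (Submodule.eq_bot_iff _).mp h u ⟨huU, Module.End.mem_eigenspace_iff.mpr hfu⟩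
  · rintro j w ⟨hwU, hw⟩
    refine ⟨hinv j w hwU, Module.End.mem_eigenspace_iff.mpr ?_⟩
    have hw' : f i w = c • w := Module.End.mem_eigenspace_iff.mp hw
    rw [← Module.End.mul_apply, (hf i j).eq, Module.End.mul_apply, hw', map_smul]
  · exact Module.End.mem_eigenspace_iff.mp (inf_eq_left.mp h hvU)

theorem Representation.IsIrreducible.finrank_le_index {k G W : Type*} [Field k] [IsAlgClosed k]
    [Group G] [AddCommGroup W] [Module k W] [FiniteDimensional k W] (ρ : Representation k G W)
    [ρ.IsIrreducible] (A : Subgroup G) [A.FiniteIndex] (hA : ∀ x ∈ A, ∀ y ∈ A, x * y = y * x) :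
    Module.finrank k W ≤ A.index := by
  have : Nontrivial W := by
    by_contra h
    rw [not_nontrivial_iff_subsingleton] at h
    exact bot_ne_top (α := Subrepresentation ρ)
      (Subrepresentation.toSubmodule_injective (Subsingleton.elim _ _))
  obtain ⟨v, hv, hvA⟩ := Module.End.exists_common_eigenvector_of_commute (fun a : A => ρ a)
    fun a b => by rw [Commute, SemiconjBy, ← map_mul, ← map_mul, hA a a.2 b b.2]
  have := Fintype.ofFinite (G ⧸ A)
  let b : G ⧸ A → W := fun q => ρ q.out v
  have hmem (g : G) : ρ g v ∈ Submodule.span k (Set.range b) := by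
    obtain ⟨a, ha⟩ := QuotientGroup.mk_out_eq_mul A g
    obtain ⟨c, hc⟩ := hvA a⁻¹
    have hg : ρ g v = c • b (g : G ⧸ A) := by
      change _ = c • ρ _ v
      rw [ha, ← map_smul, ← hc, ← Module.End.mul_apply, ← map_mul]
      simp
    rw [hg]
    exact Submodule.smul_mem _ _ (Submodule.subset_span ⟨_, rfl⟩)
  let U : Subrepresentation ρ := ⟨Submodule.span k (Set.range b), fun g w hw => by
    induction hw using Submodule.span_induction with
    | mem x hx =>
      obtain ⟨q, rfl⟩ := hx
      change ρ g (ρ q.out v) ∈ _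
      rw [← Module.End.mul_apply, ← map_mul]
      exact hmem _
    | zero => simp
    | add x y _ _ hx hy => rw [map_add]; exact Submodule.add_mem _ hx hy
    | smul c x _ hx => rw [map_smul]; exact Submodule.smul_mem _ _ hx⟩
  have hU : U = ⊤ := (eq_bot_or_eq_top U).resolve_left fun h => hv <| by
    have hb : U.toSubmodule = ⊥ := congrArg Subrepresentation.toSubmodule h
    have : ρ 1 v ∈ U.toSubmodule := hmem 1
    rw [hb] at this
    simpa using this
  have hspan : Submodule.span k (Set.range b) = ⊤ := congrArg Subrepresentation.toSubmodule hU
  have hle := finrank_range_le_card (R := k) b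
  rw [Set.finrank, hspan, finrank_top] at hle
  rwa [Subgroup.index, Nat.card_eq_fintype_card]

theorem exists_index_eq_of_faithful_isIrreducible {k G W : Type*} [Field k] [IsAlgClosed k]
    [Group G] [Finite G] [AddCommGroup W] [Module k W] [FiniteDimensional k W]
    (ρ : Representation k G W) [ρ.IsIrreducible] (hρ : Function.Injective ρ) {p : ℕ}
    (hp : p.Prime) (hG : IsPGroup p G) (hna : ¬ ∀ x y : G, x * y = y * x)
    (hW : Module.finrank k W = p) :
    ∃ A : Subgroup G, A.index = p ∧ ∀ x ∈ A, ∀ y ∈ A, x * y = y * x := by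
  have := Fact.mk hp
  have : Nontrivial W := Module.nontrivial_of_finrank_pos (R := k) (hW ▸ hp.pos)
  have hntq : Nontrivial (G ⧸ center G) := by
    rw [QuotientGroup.nontrivial_iff]
    refine fun h => hna fun x y => ?_
    exact (mem_center_iff.mp (h ▸ mem_top y) x)
  have hc := (hG.to_quotient (center G)).center_nontrivial
  obtain ⟨⟨q, hq⟩, hq1⟩ := exists_ne (1 : center (G ⧸ center G))
  obtain ⟨x, rfl⟩ := QuotientGroup.mk_surjective q
  have hx : x ∉ center G := fun h => hq1 (Subtype.ext ((QuotientGroup.eq_one_iff x).mpr h))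
  have hcomm (g : G) : x⁻¹ * (g⁻¹ * x * g) ∈ center G := by
    rw [← QuotientGroup.eq]
    have := mem_center_iff.mp hq (g : G ⧸ center G)
    rw [mul_assoc, QuotientGroup.mk_mul, QuotientGroup.mk_mul, ← this, QuotientGroup.mk_inv,
      inv_mul_cancel_left]
  choose s hs using fun g =>
    Representation.IsIrreducible.exists_smul_of_mem_center ρ (hcomm g)
  obtain ⟨μ, hμ⟩ := Module.End.exists_eigenvalue (ρ x)
  obtain ⟨v, hv⟩ := hμ.exists_hasEigenvector
  have hinj (g : G) : Function.Injective (ρ g) := fun a b h => by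
    simpa [← Module.End.mul_apply, ← map_mul] using congrArg (ρ g⁻¹) h
  have hμ0 : μ ≠ 0 := by
    rintro rfl
    refine hv.2 (hinj x ?_)
    rw [hv.apply_eq_smul, zero_smul, map_zero]
  have hrel (g : G) : ρ x (ρ g v) = (μ * s g) • ρ g v := by
    rw [← Module.End.mul_apply, ← map_mul,
      show x * g = g * x * (x⁻¹ * (g⁻¹ * x * g)) by group, map_mul, Module.End.mul_apply, hs,
      map_smul, map_mul, Module.End.mul_apply, hv.apply_eq_smul, map_smul, smul_smul, mul_comm]
  let A := centralizer ({x} : Set G)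
  have := Fintype.ofFinite (G ⧸ A)
  have hsinj : Function.Injective fun q : G ⧸ A => μ * s q.out⁻¹ := by
    intro q r h
    have h1 := mul_left_cancel₀ hμ0 h
    have h2 : ρ (x⁻¹ * (q.out⁻¹⁻¹ * x * q.out⁻¹)) = ρ (x⁻¹ * (r.out⁻¹⁻¹ * x * r.out⁻¹)) :=
      LinearMap.ext fun w => by rw [hs, hs, h1]
    have h3 := mul_left_cancel (hρ h2)
    simp only [inv_inv] at h3
    rw [← q.out_eq', ← r.out_eq']
    refine QuotientGroup.eq.mpr (mem_centralizer_singleton_iff.mpr ?_)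
    rw [mul_inv_eq_iff_eq_mul] at h3
    rw [mul_assoc, inv_mul_eq_iff_eq_mul, ← mul_assoc, ← mul_assoc, h3]
    group
  have hli : LinearIndependent k fun q : G ⧸ A => ρ q.out⁻¹ v :=
    Module.End.eigenvectors_linearIndependent' (ρ x) _ hsinj _ fun q =>
      ⟨Module.End.mem_eigenspace_iff.mpr (hrel _), fun h => hv.2 (hinj q.out⁻¹ (by rw [h, map_zero]))⟩
  have hidx : A.index = p := by
    have hle : A.index ≤ p := by
      rw [Subgroup.index, Nat.card_eq_fintype_card, ← hW]
      exact hli.fintype_card_le_finrank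
    have hne : A.index ≠ 1 := fun h => hx <| by
      rw [index_eq_one] at h
      refine mem_center_iff.mpr fun g => ?_
      exact (mem_centralizer_singleton_iff.mp (h ▸ mem_top g : g ∈ A))
    obtain ⟨m, hm⟩ := hG.index A
    have hdvd : p ∣ A.index := by
      rw [hm]
      refine dvd_pow_self p ?_
      rintro rfl
      exact hne (by simpa using hm)
    exact le_antisymm hle (Nat.le_of_dvd (Nat.pos_of_ne_zero A.index_ne_zero_of_finite) hdvd)
  refine ⟨A, hidx, fun a ha b hb => ?_⟩
  let B := basisOfLinearIndependentOfCardEqFinrank hli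
    (by rw [hW, ← hidx, Subgroup.index, Nat.card_eq_fintype_card])
  have hBx (q : G ⧸ A) : ρ x (B q) = (μ * s q.out⁻¹) • B q := by
    simpa [B] using hrel q.out⁻¹
  have hrepr (r : G ⧸ A) (w : W) : B.repr (ρ x w) r = μ * s r.out⁻¹ * B.repr w r := by
    have : (B.coord r) ∘ₗ ρ x = (μ * s r.out⁻¹) • B.coord r := by
      refine B.ext fun q => ?_
      by_cases hqr : q = r
      · subst hqr
        simp [hBx]
      · simp [hBx, hqr]
    exact LinearMap.congr_fun this w
  have hdiag (a : G) (ha : a ∈ A) (q : G ⧸ A) : ∃ c : k, ρ a (B q) = c • B q := by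
    refine ⟨B.repr (ρ a (B q)) q, B.ext_elem fun r => ?_⟩
    have hxa : ρ x (ρ a (B q)) = (μ * s q.out⁻¹) • ρ a (B q) := by
      rw [← Module.End.mul_apply, ← map_mul, ← mem_centralizer_singleton_iff.mp ha, map_mul,
        Module.End.mul_apply, hBx, map_smul]
    by_cases hqr : q = r
    · subst hqr
      simp
    · have h1 := hrepr r (ρ a (B q))
      rw [hxa, map_smul, Finsupp.smul_apply, smul_eq_mul] at h1
      have h2 : B.repr (ρ a (B q)) r = 0 := by
        by_contra h0
        exact hqr (hsinj (mul_right_cancel₀ h0 h1))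
      simp [h2, hqr]
  apply hρ
  refine B.ext fun q => ?_
  obtain ⟨c, hc⟩ := hdiag a ha q
  obtain ⟨d, hd⟩ := hdiag b hb q
  simp only [map_mul, Module.End.mul_apply, hc, hd, map_smul]
  exact smul_comm _ _ _

theorem stmt1 (G : Type) [Group G] [Finite G] (p n a : ℕ) (hp : p.Prime)
    (hcard : Nat.card G = p ^ n) (hna : ¬ ∀ x y : G, x * y = y * x)
    (ha : 1 < a) (hcd : cdSet G = {1, p, p ^ a})
    (V : FDRep ℂ G) (hV : Simple V) (hf : Function.Injective V.ρ) :
    Module.finrank ℂ V = p ^ a := by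
  have hirr := V.isIrreducible_of_simple
  have hmem : Module.finrank ℂ V ∈ cdSet G := ⟨V, hV, rfl⟩
  rw [hcd] at hmem
  rcases hmem with h1 | h1 | h1
  · refine absurd (fun x y => hf ?_) hna
    obtain ⟨v, hv, hspan⟩ := finrank_eq_one_iff'.mp h1
    obtain ⟨c, hc⟩ := hspan (V.ρ x v)
    obtain ⟨d, hd⟩ := hspan (V.ρ y v)
    ext w
    obtain ⟨e, rfl⟩ := hspan w
    simp only [map_mul, Module.End.mul_apply, map_smul, ← hc, ← hd]
    rw [smul_comm c d]
  · obtain ⟨A, hA, hAcomm⟩ :=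
      exists_index_eq_of_faithful_isIrreducible V.ρ hf hp (IsPGroup.of_card hcard) hna h1
    obtain ⟨W, hW, hWdim⟩ : p ^ a ∈ cdSet G := by simp [hcd]
    have hWirr := W.isIrreducible_of_simple
    have hle := Representation.IsIrreducible.finrank_le_index W.ρ A hAcomm
    rw [hA, hWdim] at hle
    exact absurd hle (not_le.mpr (lt_self_pow₀ hp.one_lt ha))
  · exact h1
end

section
/- Let G be a finite non-abelian p-group of order p^n (p ≥ 3) with cyclic center. Then μ(G), the minimal faithful permutation degree of G, is a power of p with p^2 ≤ μ(G) ≤ p^{n-1}. -/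
open FDRep CategoryTheory Subgroup

open scoped commutatorElement

theorem mul_pow_of_central_commutator {G : Type*} [Group G] {x y c : G}
    (hc : ∀ g, g * c = c * g) (hyx : y * x = c * (x * y)) (k : ℕ) :
    (x * y) ^ k = c ^ (∑ i ∈ Finset.range k, i) * (x ^ k * y ^ k) := by
  have hck (m : ℕ) (g : G) : g * c ^ m = c ^ m * g := (Commute.pow_right (hc g) m).eq
  have hy (m : ℕ) : y ^ m * x = c ^ m * (x * y ^ m) := by
    induction m with
    | zero => simp
    | succ m ih =>
      calc y ^ (m + 1) * x = y ^ m * (y * x) := by rw [pow_succ, mul_assoc]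
        _ = (y ^ m * c) * x * y := by rw [hyx]; simp only [mul_assoc]
        _ = c * (y ^ m * x) * y := by rw [hc]; simp only [mul_assoc]
        _ = c ^ (m + 1) * (x * y ^ (m + 1)) := by
          rw [ih, pow_succ', pow_succ]; simp only [mul_assoc]
  induction k with
  | zero => simp
  | succ k ih =>
    calc (x * y) ^ (k + 1)
        = c ^ (∑ i ∈ Finset.range k, i) * x ^ k * (y ^ k * x) * y := by
          rw [pow_succ, ih]; simp only [mul_assoc]
      _ = c ^ (∑ i ∈ Finset.range k, i) * (x ^ k * c ^ k) * x * y ^ k * y := by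
          rw [hy]; simp only [mul_assoc]
      _ = _ := by
          rw [hck, Finset.sum_range_succ, pow_add, pow_succ x, pow_succ y]
          simp only [mul_assoc]

theorem mul_pow_prime_of_central {G : Type*} [Group G] {p : ℕ} (hp : p.Prime) (hp3 : 3 ≤ p)
    (hcomm : ∀ x y : G, ⁅x, y⁆ ∈ center G) (hpow : ∀ x : G, x ^ p ∈ center G) (x y : G) :
    (x * y) ^ p = x ^ p * y ^ p := by
  have hc (g : G) : g * ⁅y, x⁆ = ⁅y, x⁆ * g := mem_center_iff.mp (hcomm y x) g
  have hyx : y * x = ⁅y, x⁆ * (x * y) := by simp [commutatorElement_def, mul_assoc]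
  have hcp : ⁅y, x⁆ ^ p = 1 := by
    have h1 : y * x * y⁻¹ = ⁅y, x⁆ * x := by simp [commutatorElement_def]
    have h2 : (y * x * y⁻¹) ^ p = x ^ p := by
      rw [conj_pow, mem_center_iff.mp (hpow x) y, mul_inv_cancel_right]
    have hcx : Commute ⁅y, x⁆ x := (hc x).symm
    rw [h1, hcx.mul_pow] at h2
    exact mul_eq_right.mp h2
  have hdvd : p ∣ ∑ i ∈ Finset.range p, i := by
    have h := Finset.sum_range_id_mul_two p
    have h2 : p ∣ (∑ i ∈ Finset.range p, i) * 2 := h ▸ dvd_mul_right p (p - 1)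
    rcases hp.dvd_mul.mp h2 with h3 | h3
    · exact h3
    · exact absurd (Nat.le_of_dvd two_pos h3) (by omega)
  obtain ⟨t, ht⟩ := hdvd
  rw [mul_pow_of_central_commutator hc hyx, ht, pow_mul, hcp, one_pow, one_mul]

theorem commute_of_card_pow_prime_eq_one_le {p : ℕ} (hp : p.Prime) (hp3 : 3 ≤ p) (n : ℕ) :
    ∀ {G : Type*} [Group G] [Finite G], Nat.card G = p ^ n →
      Nat.card {x : G // x ^ p = 1} ≤ p → ∀ x y : G, x * y = y * x := by
  have : Fact p.Prime := ⟨hp⟩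
  induction n with
  | zero =>
    intro G _ _ hcard _ x y
    have : Subsingleton G := (Nat.card_eq_one_iff_unique.mp (by simpa using hcard)).1
    exact Subsingleton.elim _ _
  | succ n ih =>
    intro G _ _ hcard hle x y
    by_contra hxy
    have habel (M : Subgroup G) (hM : Nat.card M = p ^ n) (a b : G) (ha : a ∈ M) (hb : b ∈ M) :
        a * b = b * a := by
      have h1 : Nat.card {u : M // u ^ p = 1} ≤ p := by
        refine le_trans (Nat.card_le_card_of_injective
          (fun u : {u : M // u ^ p = 1} => (⟨u.1.1, by
            have := congrArg Subtype.val u.2; simpa using this⟩ : {x : G // x ^ p = 1})) ?_) hle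
        intro u v huv
        exact Subtype.ext (Subtype.ext (congrArg (fun t => (t.1 : G)) huv))
      exact congrArg Subtype.val (ih hM h1 ⟨a, ha⟩ ⟨b, hb⟩)
    have hindex (M : Subgroup G) (hM : Nat.card M = p ^ n) : M.index = p := by
      have := M.card_mul_index
      rw [hM, hcard, pow_succ] at this
      exact Nat.eq_of_mul_eq_mul_left (pow_pos hp.pos n) this
    have hnormal (M : Subgroup G) (hM : Nat.card M = p ^ n) : M.Normal := by
      apply normal_of_index_eq_minFac_card
      rw [hindex M hM, hcard, hp.pow_minFac (Nat.succ_ne_zero n)]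
    have hmem (a b : G) (hab : a * b ≠ b * a) :
        ∃ M : Subgroup G, Nat.card M = p ^ n ∧ a ∈ M := by
      obtain ⟨k, hk, hk'⟩ := (Nat.dvd_prime_pow hp).mp (hcard ▸ (zpowers a).card_subgroup_dvd_card)
      have hkn : k ≤ n := by
        by_contra hlt
        obtain rfl : k = n + 1 := by omega
        have htop : zpowers a = ⊤ := eq_top_of_card_eq _ (hk'.trans hcard.symm)
        obtain ⟨m, rfl⟩ := mem_zpowers_iff.mp (htop ▸ mem_top b : b ∈ zpowers a)
        exact hab ((Commute.refl a).zpow_right m).eq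
      obtain ⟨M, hM, hle'⟩ := Sylow.exists_subgroup_card_pow_prime_le p
        (hcard ▸ pow_dvd_pow p n.le_succ) (zpowers a) hk' hkn
      exact ⟨M, hM, hle' (mem_zpowers a)⟩
    obtain ⟨M, hM, hxM⟩ := hmem x y hxy
    obtain ⟨N, hN, hyN⟩ := hmem y x (Ne.symm hxy)
    have hMN (w : G) (hwM : w ∈ M) (hwN : w ∈ N) : w ∈ center G := by
      have hMC : M ≤ centralizer {w} := fun m hm =>
        mem_centralizer_singleton_iff.mpr (habel M hM _ _ hm hwM)
      have hyC : y ∈ centralizer {w} := mem_centralizer_singleton_iff.mpr (habel N hN _ _ hyN hwN)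
      have hdvd : (centralizer {w}).index ∣ p := hindex M hM ▸ index_dvd_of_le hMC
      rcases (Nat.dvd_prime hp).mp hdvd with h1 | h1
      · rw [index_eq_one] at h1
        exact mem_center_iff.mpr fun g =>
          mem_centralizer_singleton_iff.mp (h1 ▸ mem_top g)
      · have hcardC : Nat.card (centralizer {w}) ≤ Nat.card M := by
          have h2 := M.card_mul_index
          rw [← (centralizer {w}).card_mul_index, hindex M hM, h1] at h2
          exact (Nat.eq_of_mul_eq_mul_right hp.pos h2).ge
        have hEq := eq_of_le_of_card_ge hMC hcardC
        exact absurd (habel M hM x y hxM (hEq ▸ hyC)) hxy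
    have hquot (K : Subgroup G) (hK : Nat.card K = p ^ n) :
        (∀ a b : G, ⁅a, b⁆ ∈ K) ∧ ∀ a : G, a ^ p ∈ K := by
      have := hnormal K hK
      have hcardQ : Nat.card (G ⧸ K) = p := hindex K hK
      have : IsCyclic (G ⧸ K) := isCyclic_of_prime_card hcardQ
      refine ⟨fun a b => ?_, fun a => ?_⟩
      · rw [← QuotientGroup.eq_one_iff, ← QuotientGroup.mk'_apply, map_commutatorElement,
          commutatorElement_eq_one_iff_mul_comm]
        exact IsMulCommutative.is_comm.comm _ _
      · rw [← QuotientGroup.eq_one_iff, QuotientGroup.mk_pow]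
        conv_lhs => rw [← hcardQ]
        exact pow_card_eq_one'
    have hcomm (a b : G) : ⁅a, b⁆ ∈ center G :=
      hMN _ ((hquot M hM).1 a b) ((hquot N hN).1 a b)
    have hpow (a : G) : a ^ p ∈ center G := hMN _ ((hquot M hM).2 a) ((hquot N hN).2 a)
    let f : G →* G := MonoidHom.mk' (· ^ p) (mul_pow_prime_of_central hp hp3 hcomm hpow)
    have hker : Nat.card f.ker ≤ p := hle
    have hrange : f.range ≤ center G := by
      rintro _ ⟨a, rfl⟩
      exact hpow a
    have hindexZ : (center G).index ≤ p := by
      calc (center G).index ≤ f.range.index := Nat.le_of_dvd (Nat.pos_of_ne_zero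
            index_ne_zero_of_finite) (index_dvd_of_le hrange)
        _ = Nat.card f.ker := index_range
        _ ≤ p := hker
    have hdvdZ : Nat.card (G ⧸ center G) ∣ p := by
      obtain ⟨k, hk⟩ := (IsPGroup.of_card hcard).index (center G)
      change (center G).index ∣ p
      rw [hk] at hindexZ ⊢
      have hk1 : k ≤ 1 := (Nat.pow_le_pow_iff_right hp.one_lt).mp (by simpa using hindexZ)
      simpa using pow_dvd_pow p hk1
    have : IsCyclic (G ⧸ center G) := isCyclic_of_card_dvd_prime hdvdZ
    have : IsMulCommutative G := isMulCommutative_of_isCyclic_quotient_center_self G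
    exact hxy (IsMulCommutative.is_comm.comm x y)

theorem card_pow_eq_one_le_of_isCyclic_center {G : Type*} [Group G] [Finite G]
    [IsCyclic (center G)] {p : ℕ} (hp : 0 < p) : Nat.card {x : center G // x ^ p = 1} ≤ p := by
  classical
  have := Fintype.ofFinite (center G)
  rw [Nat.card_eq_fintype_card, Fintype.card_subtype]
  exact IsCyclic.card_pow_eq_one_le hp

theorem exists_pow_eq_one_notMem_center {G : Type*} [Group G] [Finite G] {p n : ℕ}
    (hp : p.Prime) (hp3 : 3 ≤ p) (hcard : Nat.card G = p ^ n)
    (hna : ¬ ∀ x y : G, x * y = y * x) [IsCyclic (center G)] :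
    ∃ x : G, x ^ p = 1 ∧ x ∉ center G := by
  by_contra! h
  refine hna (commute_of_card_pow_prime_eq_one_le hp hp3 n hcard (le_trans ?_
    (card_pow_eq_one_le_of_isCyclic_center (G := G) hp.pos)))
  refine Nat.card_le_card_of_injective (fun u : {u : G // u ^ p = 1} =>
    (⟨⟨u.1, h u.1 u.2⟩, Subtype.ext u.2⟩ : {x : center G // x ^ p = 1})) ?_
  intro u v huv
  exact Subtype.ext (congrArg (fun t => (t.1 : G)) huv)

theorem IsPGroup.exists_mem_center_of_normal_ne_bot {G : Type*} [Group G] [Finite G] {p : ℕ}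
    [Fact p.Prime] (hG : IsPGroup p G) {N : Subgroup G} [N.Normal] (hN : N ≠ ⊥) :
    ∃ w ∈ N, w ∈ center G ∧ orderOf w = p := by
  have : Nontrivial N := N.nontrivial_iff_ne_bot.mpr hN
  obtain ⟨k, hk, hcardN⟩ := (hG.to_subgroup N).nontrivial_iff_card.mp this
  have hact : IsPGroup p (ConjAct G) := hG.of_equiv ConjAct.toConjAct
  obtain ⟨b, hb, hb1⟩ := hact.exists_fixed_point_of_prime_dvd_card_of_fixed_point N
    (hcardN ▸ dvd_pow_self p hk.ne') (a := 1) (fun g => smul_one g)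
  have hbZ : (b : G) ∈ center G := by
    rw [mem_center_iff]
    intro g
    have h := congrArg Subtype.val (hb (ConjAct.toConjAct g))
    rw [ConjAct.Subgroup.val_conj_smul, ConjAct.toConjAct_smul] at h
    exact mul_inv_eq_iff_eq_mul.mp h
  have hdvd : p ∣ orderOf (b : G) := hG.dvd_orderOf fun h => hb1 (Subtype.ext h.symm)
  refine ⟨(b : G) ^ (orderOf (b : G) / p), N.pow_mem b.2 _, (center G).pow_mem hbZ _, ?_⟩
  exact orderOf_pow_orderOf_div (orderOf_pos _).ne' hdvd

theorem mem_zpowers_of_center_orderOf_eq {G : Type*} [Group G] [Finite G] {p : ℕ} (hp : 0 < p)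
    [IsCyclic (center G)] {z w : G} (hz : z ∈ center G) (hw : w ∈ center G)
    (hzp : orderOf z = p) (hwp : orderOf w = p) : z ∈ zpowers w := by
  have hcardle := card_pow_eq_one_le_of_isCyclic_center (G := G) hp
  have hle : zpowers w ≤ center G := zpowers_le.mpr hw
  let F : zpowers w → {x : center G // x ^ p = 1} := fun u => ⟨⟨u.1, hle u.2⟩, by
    obtain ⟨m, hm⟩ := mem_zpowers_iff.mp u.2
    apply Subtype.ext
    change (u : G) ^ p = 1
    rw [← hm, ← hwp, ← zpow_natCast, zpow_comm, zpow_natCast, pow_orderOf_eq_one, one_zpow]⟩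
  have hF : Function.Injective F := fun u v huv =>
    Subtype.ext (congrArg (fun t => (t.1 : G)) huv)
  have hbij : Function.Bijective F := hF.bijective_of_nat_card_le
    (by rw [Nat.card_zpowers, hwp]; exact hcardle)
  obtain ⟨u, hu⟩ := hbij.2 ⟨⟨z, hz⟩, Subtype.ext (hzp ▸ pow_orderOf_eq_one z)⟩
  have huz : (u : G) = z := congrArg (fun t => (t.1 : G)) hu
  exact huz ▸ u.2

theorem exists_injective_perm_index {G : Type*} [Group G] [Finite G] {H : Subgroup G}
    (hH : H.normalCore = ⊥) :
    ∃ f : G →* Equiv.Perm (Fin H.index), Function.Injective f := by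
  refine ⟨((Finite.equivFin (G ⧸ H)).permCongrHom.toMonoidHom).comp
    (MulAction.toPermHom G (G ⧸ H)), ?_⟩
  refine (Finite.equivFin (G ⧸ H)).permCongrHom.injective.comp ?_
  rw [← MonoidHom.ker_eq_bot_iff, ← normalCore_eq_ker, hH]

theorem exists_normalCore_eq_bot_index_le {G : Type*} [Group G] [Finite G] {p m : ℕ}
    [Fact p.Prime] (hG : IsPGroup p G) [IsCyclic (center G)] [Nontrivial G]
    (f : G →* Equiv.Perm (Fin m)) (hf : Function.Injective f) :
    ∃ H : Subgroup G, H.normalCore = ⊥ ∧ H.index ≤ m := by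
  obtain ⟨z, -, hz, hzp⟩ := hG.exists_mem_center_of_normal_ne_bot (N := ⊤) top_ne_bot
  have hz1 : z ≠ 1 := by
    rintro rfl
    exact (Fact.out : p.Prime).one_lt.ne (by simpa using hzp)
  obtain ⟨a, ha⟩ : ∃ a, f z a ≠ a := by
    by_contra! h
    exact hz1 (hf (by ext a; simp [h a]))
  let _ : MulAction G (Fin m) := MulAction.compHom (Fin m) f
  refine ⟨MulAction.stabilizer G a, ?_, ?_⟩
  · by_contra hne
    obtain ⟨w, hwN, hw, hwp⟩ := hG.exists_mem_center_of_normal_ne_bot hne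
    exact ha (normalCore_le _ (zpowers_le.mpr hwN
      (mem_zpowers_of_center_orderOf_eq (Fact.out : p.Prime).pos hz hw hzp hwp)))
  · rw [MulAction.index_stabilizer]
    exact (Set.ncard_le_card _).trans_eq (Nat.card_fin m)

theorem permDegree_le_index {G : Type*} [Group G] [Finite G] {H : Subgroup G}
    (hH : H.normalCore = ⊥) : permDegree G ≤ H.index :=
  Nat.sInf_le (exists_injective_perm_index hH)

theorem exists_normalCore_eq_bot_index_eq_permDegree {G : Type*} [Group G] [Finite G] {p : ℕ}
    [Fact p.Prime] (hG : IsPGroup p G) [IsCyclic (center G)] [Nontrivial G] :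
    ∃ H : Subgroup G, H.normalCore = ⊥ ∧ permDegree G = H.index := by
  have hne : {n | ∃ f : G →* Equiv.Perm (Fin n), Function.Injective f}.Nonempty :=
    ⟨_, exists_injective_perm_index (normalCore_eq_self (⊥ : Subgroup G))⟩
  obtain ⟨f, hf⟩ := Nat.sInf_mem hne
  obtain ⟨H, hH, hle⟩ := exists_normalCore_eq_bot_index_le hG f hf
  exact ⟨H, hH, (permDegree_le_index hH).antisymm hle⟩

theorem stmt7 (G : Type*) [Group G] [Finite G] (p n : ℕ) (hp : p.Prime) (hp3 : 3 ≤ p)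
    (hcard : Nat.card G = p ^ n) (hna : ¬ ∀ x y : G, x * y = y * x)
    (hc : IsCyclic (Subgroup.center G)) :
    ∃ i : ℕ, 2 ≤ i ∧ i ≤ n - 1 ∧ permDegree G = p ^ i := by
  have : Fact p.Prime := ⟨hp⟩
  have hG : IsPGroup p G := .of_card hcard
  have : Nontrivial G := by
    by_contra h
    rw [not_nontrivial_iff_subsingleton] at h
    exact hna fun x y => Subsingleton.elim _ _
  obtain ⟨H, hH, hdeg⟩ := exists_normalCore_eq_bot_index_eq_permDegree hG
  obtain ⟨i, hi⟩ := hG.index H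
  refine ⟨i, ?_, ?_, hdeg.trans hi⟩
  · by_contra! hlt
    have hindex : H.index ∣ p := by
      simpa [hi] using pow_dvd_pow p (Nat.le_of_lt_succ hlt)
    have hnormal : H.Normal := by
      rcases (Nat.dvd_prime hp).mp hindex with h | h
      · exact normal_of_index_eq_one h
      · apply normal_of_index_eq_minFac_card
        have hn : n ≠ 0 := by
          rintro rfl
          exact Finite.one_lt_card.ne' (by simpa using hcard)
        rw [h, hcard, hp.pow_minFac hn]
    rw [normalCore_eq_self] at hH
    rw [hH, index_bot] at hindex
    have : IsCyclic G := isCyclic_of_card_dvd_prime hindex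
    exact hna fun x y => IsMulCommutative.is_comm.comm x y
  · obtain ⟨x, hxp, hx⟩ := exists_pow_eq_one_notMem_center hp hp3 hcard hna
    have hx1 : x ≠ 1 := fun h => hx (h ▸ one_mem _)
    have hcore : (zpowers x).normalCore = ⊥ := by
      by_contra hne
      obtain ⟨w, hwN, hw, hwp⟩ := hG.exists_mem_center_of_normal_ne_bot hne
      have hle : zpowers w ≤ zpowers x := zpowers_le.mpr (normalCore_le _ hwN)
      have heq : zpowers w = zpowers x := eq_of_le_of_card_ge hle (by
        rw [Nat.card_zpowers, Nat.card_zpowers, hwp, orderOf_eq_prime hxp hx1])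
      exact hx (zpowers_le.mpr hw (heq ▸ mem_zpowers x))
    have hle := permDegree_le_index hcore
    rw [hdeg, hi] at hle
    have hmul := (zpowers x).card_mul_index
    rw [Nat.card_zpowers, orderOf_eq_prime hxp hx1, hcard] at hmul
    have hpow : p ^ (i + 1) ≤ p ^ n := by
      rw [pow_succ', ← hmul]
      exact Nat.mul_le_mul_left p hle
    have := (Nat.pow_le_pow_iff_right hp.one_lt).mp hpow
    omega
end

section
/- For every n ≥ 3, every i with 2 ≤ i ≤ n-1, and every prime p ≥ n, there exists a non-abelian group G of order p^n with cyclic center such that μ(G) = p^i. -/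
open FDRep CategoryTheory Subgroup

theorem IsPGroup.exists_ne_one_mem_center_of_normal {p : ℕ} [Fact p.Prime] {G : Type*} [Group G]
    [Finite G] (hG : IsPGroup p G) (N : Subgroup G) [N.Normal] (hN : N ≠ ⊥) :
    ∃ b ∈ N, b ≠ 1 ∧ b ∈ Subgroup.center G := by
  have hC : IsPGroup p (ConjAct G) := hG.of_equiv ConjAct.toConjAct
  have := (Subgroup.nontrivial_iff_ne_bot N).2 hN
  have hcard : p ∣ Nat.card N := by
    obtain ⟨n, hn, h⟩ := (hG.to_subgroup N).nontrivial_iff_card.1 this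
    exact h ▸ dvd_pow_self p hn.ne'
  obtain ⟨b, hb, hb1⟩ := hC.exists_fixed_point_of_prime_dvd_card_of_fixed_point N hcard
    (a := 1) (fun g => smul_one g)
  refine ⟨b, b.2, fun h => hb1 (Subtype.ext h.symm), Subgroup.mem_center_iff.2 fun g => ?_⟩
  have := congrArg Subtype.val (hb (ConjAct.toConjAct g))
  rw [ConjAct.Subgroup.val_conj_smul, ConjAct.toConjAct_smul] at this
  rw [← mul_inv_eq_iff_eq_mul, this]

theorem IsPGroup.exists_ne_one_mem_of_isCyclic {p : ℕ} [hp : Fact p.Prime] {C : Type*} [CommGroup C]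
    [Finite C] [IsCyclic C] [Nontrivial C] (hC : IsPGroup p C) :
    ∃ z : C, z ≠ 1 ∧ ∀ K : Subgroup C, K ≠ ⊥ → z ∈ K := by
  have hdvd : ∀ K : Subgroup C, K ≠ ⊥ → p ∣ Nat.card K := fun K hK => by
    obtain ⟨n, hn, h⟩ := (hC.to_subgroup K).nontrivial_iff_card.1
      ((Subgroup.nontrivial_iff_ne_bot K).2 hK)
    exact h ▸ dvd_pow_self p hn.ne'
  have hker : Nat.card (powMonoidHom p : C →* C).ker = p := by
    rw [IsCyclic.card_powMonoidHom_ker, Nat.gcd_eq_right]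
    simpa using hdvd ⊤ top_ne_bot
  have hle : ∀ K : Subgroup C, K ≠ ⊥ → (powMonoidHom p : C →* C).ker ≤ K := fun K hK => by
    obtain ⟨w, hw⟩ := exists_prime_orderOf_dvd_card' p (hdvd K hK)
    have hwo : orderOf (w : C) = p := by rw [Subgroup.orderOf_coe, hw]
    have hz : Subgroup.zpowers (w : C) ≤ (powMonoidHom p : C →* C).ker := by
      rw [Subgroup.zpowers_le, MonoidHom.mem_ker, powMonoidHom_apply, ← hwo, pow_orderOf_eq_one]
    rw [← Subgroup.eq_of_le_of_card_ge hz (by rw [hker, Nat.card_zpowers, hwo]),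
      Subgroup.zpowers_le]
    exact w.2
  have hne : (powMonoidHom p : C →* C).ker ≠ ⊥ := fun h => by
    rw [h, Subgroup.card_bot] at hker
    exact hp.out.one_lt.ne hker
  obtain ⟨z, hz1⟩ := Subgroup.ne_bot_iff_exists_ne_one.1 hne
  exact ⟨z, fun h => hz1 (Subtype.ext h), fun K hK => hle K hK z.2⟩

/-- A faithful permutation representation of a `p`-group with cyclic center has a point stabilizer
which meets the center trivially. -/
theorem IsPGroup.exists_disjoint_center_index_le {p : ℕ} [Fact p.Prime] {G : Type*} [Group G]
    [Finite G] [Nontrivial G] (hG : IsPGroup p G) [IsCyclic (Subgroup.center G)] {N : ℕ}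
    (f : G →* Equiv.Perm (Fin N)) (hf : Function.Injective f) :
    ∃ H : Subgroup G, Disjoint H (Subgroup.center G) ∧ H.index ≤ N := by
  have := hG.center_nontrivial
  let := IsCyclic.commGroup (α := Subgroup.center G)
  obtain ⟨z, hz1, hz⟩ := IsPGroup.exists_ne_one_mem_of_isCyclic (C := Subgroup.center G)
    (hG.to_subgroup (Subgroup.center G))
  have hfz : f z ≠ 1 := fun h => hz1 (Subtype.ext (hf (h.trans f.map_one.symm)))
  obtain ⟨t, ht⟩ : ∃ t, f z t ≠ t := by
    by_contra! h
    exact hfz (Equiv.ext h)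
  let := MulAction.compHom (Fin N) f
  refine ⟨MulAction.stabilizer G t, ?_, ?_⟩
  · rw [← Subgroup.subgroupOf_eq_bot]
    by_contra h
    exact ht (Subgroup.mem_subgroupOf.1 (hz _ h))
  · rw [MulAction.index_stabilizer]
    exact (Set.ncard_le_ncard (Set.subset_univ _)).trans_eq (by simp)

/-- In a `p`-group with an abelian subgroup `A` of index `p`, a subgroup meeting the center
trivially is either small or embeds into the quotient of `A` by the center. -/
theorem IsPGroup.card_le_or_card_mul_card_center_le {p : ℕ} [hp : Fact p.Prime] {G : Type*}
    [Group G] [Finite G] (hG : IsPGroup p G) (A : Subgroup G) [A.Normal]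
    (hA : ∀ a ∈ A, ∀ b ∈ A, a * b = b * a) (hi : A.index = p) (hZ : Subgroup.center G ≤ A)
    (H : Subgroup G) (hd : Disjoint H (Subgroup.center G)) :
    Nat.card H ≤ p ∨ Nat.card H * Nat.card (Subgroup.center G) ≤ Nat.card A := by
  by_cases hHA : H ≤ A
  · right
    rw [← Nat.card_prod]
    refine Nat.card_le_card_of_injective
      (fun x => (⟨x.1 * x.2, mul_mem (hHA x.1.2) (hZ x.2.2)⟩ : A)) fun x y hxy => ?_
    exact Subgroup.mul_injective_of_disjoint hd (congrArg Subtype.val hxy)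
  left
  obtain ⟨h, hh, hhA⟩ := SetLike.not_le_iff_exists.1 hHA
  have hbot : A.subgroupOf H = ⊥ := by
    by_contra hne
    obtain ⟨b, hbA, hb1, hbc⟩ :=
      (hG.to_subgroup H).exists_ne_one_mem_center_of_normal (A.subgroupOf H) hne
    rw [Subgroup.mem_subgroupOf] at hbA
    have hle : A ≤ Subgroup.centralizer {(b : G)} := fun a ha =>
      Subgroup.mem_centralizer_singleton_iff.2 (hA a ha b hbA)
    have hhc : h ∈ Subgroup.centralizer {(b : G)} :=
      Subgroup.mem_centralizer_singleton_iff.2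
        (congrArg Subtype.val (Subgroup.mem_center_iff.1 hbc ⟨h, hh⟩))
    have htop : Subgroup.centralizer {(b : G)} = ⊤ := by
      have hmul := Subgroup.relIndex_mul_index hle
      rw [hi] at hmul
      rcases (Nat.dvd_prime hp.out).1 (Dvd.intro_left _ hmul) with h1 | h1
      · exact Subgroup.index_eq_one.1 h1
      · rw [h1, Nat.mul_eq_right hp.out.ne_zero, Subgroup.relIndex_eq_one] at hmul
        exact absurd (hmul hhc) hhA
    refine hb1 (Subtype.ext ((Subgroup.disjoint_def.1 hd) b.2 ?_))
    refine Subgroup.mem_center_iff.2 fun g => ?_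
    exact Subgroup.mem_centralizer_singleton_iff.1 (htop ▸ Subgroup.mem_top g)
  have hrel : A.relIndex H = Nat.card H := by
    rw [Subgroup.relIndex, hbot, Subgroup.index_bot]
  exact Nat.le_of_dvd hp.out.pos (hrel ▸ hi ▸ Subgroup.relIndex_dvd_index_of_normal A H)

section Shear

variable {R M : Type*} [AddCommGroup R] [AddCommGroup M]

/-- The permutation `(x, y) ↦ (x + a, y + f x)` of `R × M`. -/
def shear (a : R) (f : R → M) : Equiv.Perm (R × M) where
  toFun q := (q.1 + a, q.2 + f q.1)
  invFun q := (q.1 - a, q.2 - f (q.1 - a))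
  left_inv q := by simp
  right_inv q := by simp

@[simp]
theorem shear_apply (a : R) (f : R → M) (q : R × M) : shear a f q = (q.1 + a, q.2 + f q.1) := rfl

theorem shear_mul (a b : R) (f g : R → M) :
    shear a f * shear b g = shear (a + b) (fun x => g x + f (x + b)) := by
  ext q <;> simp only [Equiv.Perm.mul_apply, shear_apply] <;> abel

theorem shear_zero : shear (0 : R) (0 : R → M) = 1 := by
  ext q <;> simp

theorem shear_inv (a : R) (f : R → M) :
    (shear a f)⁻¹ = shear (-a) (fun x => -f (x + -a)) := by
  rw [inv_eq_iff_mul_eq_one, shear_mul]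
  ext q <;> simp

theorem shear_inj {a b : R} {f g : R → M} : shear a f = shear b g ↔ a = b ∧ f = g := by
  refine ⟨fun h => ?_, fun ⟨h, h'⟩ => h ▸ h' ▸ rfl⟩
  have h' : ∀ x, (x + a, f x) = (x + b, g x) := fun x => by
    simpa using congrArg (fun σ : Equiv.Perm (R × M) => σ (x, 0)) h
  exact ⟨by simpa using congrArg Prod.fst (h' 0), funext fun x => congrArg Prod.snd (h' x)⟩

/-- The group of all shears `(x, y) ↦ (x + a, y + f x)` with `f` in a translation-invariant
group `A` of functions. -/
def shearGroup (A : AddSubgroup (R → M)) (hA : ∀ f ∈ A, ∀ a : R, (fun x => f (x + a)) ∈ A) :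
    Subgroup (Equiv.Perm (R × M)) where
  carrier := {σ | ∃ a, ∃ f ∈ A, σ = shear a f}
  one_mem' := ⟨0, 0, A.zero_mem, shear_zero.symm⟩
  mul_mem' := by
    rintro _ _ ⟨a, f, hf, rfl⟩ ⟨b, g, hg, rfl⟩
    exact ⟨_, _, A.add_mem hg (hA f hf b), shear_mul a b f g⟩
  inv_mem' := by
    rintro _ ⟨a, f, hf, rfl⟩
    exact ⟨_, _, A.neg_mem (hA f hf (-a)), shear_inv a f⟩

variable {A : AddSubgroup (R → M)} {hA : ∀ f ∈ A, ∀ a : R, (fun x => f (x + a)) ∈ A}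

theorem shear_mem_shearGroup {a : R} {f : R → M} (hf : f ∈ A) : shear a f ∈ shearGroup A hA :=
  ⟨a, f, hf, rfl⟩

theorem card_shearGroup : Nat.card (shearGroup A hA) = Nat.card R * Nat.card A := by
  rw [← Nat.card_prod]
  refine (Nat.card_congr (Equiv.ofBijective
    (fun q : R × A => (⟨shear q.1 q.2, shear_mem_shearGroup q.2.2⟩ : shearGroup A hA))
    ⟨fun q r h => ?_, fun σ => ?_⟩)).symm
  · obtain ⟨h1, h2⟩ := shear_inj.1 (congrArg Subtype.val h)
    exact Prod.ext h1 (Subtype.ext h2)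
  · obtain ⟨_, a, f, hf, rfl⟩ := σ
    exact ⟨(a, ⟨f, hf⟩), rfl⟩

variable (A hA) in
/-- The translation part of a shear. -/
def shearTranslation : shearGroup A hA →* Multiplicative R where
  toFun σ := Multiplicative.ofAdd (σ.1 (0, 0)).1
  map_one' := rfl
  map_mul' := by
    rintro ⟨_, a, f, hf, rfl⟩ ⟨_, b, g, hg, rfl⟩
    simp [← ofAdd_add, add_comm]

theorem mem_ker_shearTranslation {σ : shearGroup A hA} :
    σ ∈ (shearTranslation A hA).ker ↔ ∃ f ∈ A, σ.1 = shear 0 f := by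
  obtain ⟨_, a, f, hf, rfl⟩ := σ
  rw [MonoidHom.mem_ker]
  change (0 + a = 0) ↔ _
  constructor
  · rw [zero_add]
    rintro rfl
    exact ⟨f, hf, rfl⟩
  · rintro ⟨g, -, h⟩
    rw [zero_add, (shear_inj.1 h).1]

theorem index_ker_shearTranslation : (shearTranslation A hA).ker.index = Nat.card R := by
  have hsurj : Function.Surjective (shearTranslation A hA) := fun a =>
    ⟨⟨shear a.toAdd 0, shear_mem_shearGroup A.zero_mem⟩, congrArg Multiplicative.ofAdd (zero_add _)⟩
  rw [Subgroup.index_ker, MonoidHom.range_eq_top.2 hsurj, Subgroup.card_top]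
  rfl

theorem commute_of_mem_ker_shearTranslation {σ τ : shearGroup A hA}
    (hσ : σ ∈ (shearTranslation A hA).ker) (hτ : τ ∈ (shearTranslation A hA).ker) :
    σ * τ = τ * σ := by
  obtain ⟨f, -, hf⟩ := mem_ker_shearTranslation.1 hσ
  obtain ⟨g, -, hg⟩ := mem_ker_shearTranslation.1 hτ
  ext1
  rw [Subgroup.coe_mul, Subgroup.coe_mul, hf, hg, shear_mul, shear_mul]
  simp [add_comm]

theorem mem_center_shearGroup_iff (hinj : ∀ a : R, (∀ g ∈ A, ∀ x, g (x + a) = g x) → a = 0)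
    {σ : shearGroup A hA} :
    σ ∈ Subgroup.center (shearGroup A hA) ↔ ∃ c : M, σ.1 = shear 0 (fun _ => c) := by
  rw [Subgroup.mem_center_iff]
  constructor
  · obtain ⟨_, a, f, hf, rfl⟩ := σ
    intro h
    have hcomm : ∀ b : R, ∀ g ∈ A, ∀ x, f x + g (x + a) = g x + f (x + b) := fun b g hg => by
      have := congrArg Subtype.val (h ⟨shear b g, shear_mem_shearGroup hg⟩)
      rw [Subgroup.coe_mul, Subgroup.coe_mul, shear_mul, shear_mul] at this
      exact congrFun (shear_inj.1 this).2
    have ha : a = 0 := hinj a fun g hg x => by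
      have := hcomm 0 g hg x
      rwa [add_zero, add_comm, add_left_inj] at this
    refine ⟨f 0, shear_inj.2 ⟨ha, funext fun x => ?_⟩⟩
    simpa using (hcomm x 0 A.zero_mem 0).symm
  · rintro ⟨c, hc⟩ ⟨_, a, f, hf, rfl⟩
    ext1
    rw [Subgroup.coe_mul, Subgroup.coe_mul, hc, shear_mul, shear_mul]
    simp [add_comm]

/-- The center of a shear group is the group of constant shears. -/
noncomputable def centerShearGroupEquiv
    (hinj : ∀ a : R, (∀ g ∈ A, ∀ x, g (x + a) = g x) → a = 0) (hc : ∀ c : M, (fun _ => c) ∈ A) :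
    Multiplicative M ≃* Subgroup.center (shearGroup A hA) :=
  MulEquiv.ofBijective
    (MonoidHom.mk' (fun c : Multiplicative M =>
      (⟨⟨shear 0 (fun _ => c.toAdd), shear_mem_shearGroup (hc _)⟩,
        (mem_center_shearGroup_iff hinj).2 ⟨_, rfl⟩⟩ : Subgroup.center (shearGroup A hA)))
      fun c d => by
        ext1
        ext1
        simp [shear_mul, add_comm])
    ⟨fun c d h => by
      have h' : shear (0 : R) (fun _ => c.toAdd) = shear 0 (fun _ => d.toAdd) :=
        congrArg (fun τ : Subgroup.center (shearGroup A hA) => τ.1.1) h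
      exact congrFun (shear_inj.1 h').2 0, fun σ => by
      obtain ⟨c, hc⟩ := (mem_center_shearGroup_iff hinj).1 σ.2
      exact ⟨Multiplicative.ofAdd c, Subtype.ext (Subtype.ext hc.symm)⟩⟩

end Shear

section Polynomial

open Polynomial

variable {R M : Type*} [CommRing R] [AddCommGroup M]

/-- The functions `x ↦ c + ι (P x)` with `c` constant and `P` a polynomial of degree at most `k`. -/
def polyFunctions (ι : R →+ M) (k : ℕ) : AddSubgroup (R → M) where
  carrier := {f | ∃ c : M, ∃ P : R[X], P.natDegree ≤ k ∧ f = fun x => c + ι (P.eval x)}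
  zero_mem' := ⟨0, 0, by simp, by ext; simp⟩
  add_mem' := by
    rintro _ _ ⟨c, P, hP, rfl⟩ ⟨d, Q, hQ, rfl⟩
    refine ⟨c + d, P + Q, natDegree_add_le_of_degree_le hP hQ, ?_⟩
    ext x
    simp only [Pi.add_apply, eval_add, map_add]
    abel
  neg_mem' := by
    rintro _ ⟨c, P, hP, rfl⟩
    refine ⟨-c, -P, by rwa [natDegree_neg], ?_⟩
    ext x
    simp [add_comm]

variable (ι : R →+ M) (k : ℕ)

theorem translate_mem_polyFunctions : ∀ f ∈ polyFunctions ι k, ∀ a : R,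
    (fun x => f (x + a)) ∈ polyFunctions ι k := by
  rintro _ ⟨c, P, hP, rfl⟩ a
  refine ⟨c, P.comp (X + C a), natDegree_comp_le.trans ?_, by simp⟩
  nontriviality R
  rwa [natDegree_X_add_C, mul_one]

theorem const_mem_polyFunctions (c : M) : (fun _ => c) ∈ polyFunctions ι k :=
  ⟨c, 0, by simp, by simp⟩

theorem eq_zero_of_periodic_polyFunctions {ι : R →+ M} (hι : Function.Injective ι) {k : ℕ}
    (hk : 1 ≤ k) (a : R) (h : ∀ g ∈ polyFunctions ι k, ∀ x, g (x + a) = g x) : a = 0 := by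
  have := h (fun x => ι x) ⟨0, X, natDegree_X_le.trans hk, by simp⟩ 0
  rw [zero_add] at this
  exact hι this

theorem card_polyFunctions [IsDomain R] {ι : R →+ M} (hι : Function.Injective ι) {k : ℕ}
    (hk : k < Nat.card R) :
    Nat.card (polyFunctions ι k) = Nat.card M * Nat.card R ^ k := by
  have := Nat.finite_of_card_ne_zero (Nat.ne_zero_of_lt hk)
  have := Fintype.ofFinite R
  have hlt : Nat.card (degreeLT R k) = Nat.card R ^ k := by
    rw [Nat.card_congr (degreeLTEquiv R k).toEquiv, Nat.card_fun, Nat.card_fin]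
  have hdeg : ∀ Q ∈ degreeLT R k, (X * Q).natDegree ≤ k := fun Q hQ => by
    by_cases h0 : Q = 0
    · simp [h0]
    rw [natDegree_X_mul h0]
    exact (natDegree_lt_iff_degree_lt h0).2 (mem_degreeLT.1 hQ)
  rw [← hlt, ← Nat.card_prod]
  refine (Nat.card_congr (Equiv.ofBijective (fun q : M × degreeLT R k =>
    (⟨fun x => q.1 + ι ((X * q.2.1).eval x), q.1, _, hdeg _ q.2.2, rfl⟩ : polyFunctions ι k))
    ⟨fun q r h => ?_, fun f => ?_⟩)).symm
  · have h' := congrFun (congrArg Subtype.val h)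
    have h1 : q.1 = r.1 := by simpa using h' 0
    refine Prod.ext h1 (Subtype.ext (sub_eq_zero.1 ?_))
    have hX : X * (q.2.1 - r.2.1) = 0 := by
      refine eq_zero_of_natDegree_lt_card_of_eval_eq_zero _ Function.injective_id (fun x => ?_)
        ((hdeg _ (sub_mem q.2.2 r.2.2)).trans_lt (Nat.card_eq_fintype_card (α := R) ▸ hk))
      have hx := h' x
      simp only [h1, add_right_inj] at hx
      rw [mul_sub, eval_sub, id, hι hx, sub_self]
    exact (mul_eq_zero.1 hX).resolve_left X_ne_zero
  · obtain ⟨_, c, P, hP, rfl⟩ := f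
    refine ⟨(c + ι (P.coeff 0), ⟨P.divX, mem_degreeLT.2 ?_⟩), Subtype.ext (funext fun x => ?_)⟩
    · by_cases h0 : P.divX = 0
      · simp [h0]
      rw [← natDegree_lt_iff_degree_lt h0, natDegree_divX_eq_natDegree_tsub_one]
      have : P.natDegree ≠ 0 := fun h => h0 (by rw [eq_C_of_natDegree_eq_zero h, divX_C])
      omega
    · dsimp only
      conv_rhs => rw [← X_mul_divX_add P]
      rw [eval_add, eval_C, map_add]
      abel

end Polynomial

theorem ZMod.exists_injective_addMonoidHom_pow {p m : ℕ} (hp : p ≠ 0) (hm : m ≠ 0) :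
    ∃ ι : ZMod p →+ ZMod (p ^ m), Function.Injective ι := by
  obtain ⟨m, rfl⟩ := Nat.exists_eq_succ_of_ne_zero hm
  let g : ℤ →+ ZMod (p ^ (m + 1)) :=
    (Int.castAddHom _).comp (AddMonoidHom.mulLeft ((p : ℤ) ^ m))
  have hg : ∀ j : ℤ, g j = 0 ↔ (p : ℤ) ∣ j := fun j => by
    change (((p : ℤ) ^ m * j : ℤ) : ZMod (p ^ (m + 1))) = 0 ↔ _
    rw [ZMod.intCast_zmod_eq_zero_iff_dvd, Nat.cast_pow, pow_succ]
    exact mul_dvd_mul_iff_left (by positivity)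
  refine ⟨ZMod.lift p ⟨g, (hg _).2 dvd_rfl⟩, (ZMod.lift_injective _).2 fun j hj => ?_⟩
  exact (ZMod.intCast_zmod_eq_zero_iff_dvd _ _).2 ((hg j).1 hj)

theorem stmt8 (n : ℕ) (hn : 3 ≤ n) (i : ℕ) (hi2 : 2 ≤ i) (hi : i ≤ n - 1)
    (p : ℕ) (hp : p.Prime) (hpn : n ≤ p) :
    ∃ (G : Type) (_ : Group G) (_ : Finite G), Nat.card G = p ^ n ∧
      (¬ ∀ x y : G, x * y = y * x) ∧ IsCyclic (Subgroup.center G) ∧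
      permDegree G = p ^ i := by
  have : Fact p.Prime := ⟨hp⟩
  obtain ⟨m, rfl⟩ : ∃ m, i = m + 1 := ⟨i - 1, by omega⟩
  obtain ⟨k, rfl⟩ : ∃ k, n = m + 1 + k := ⟨n - (m + 1), by omega⟩
  have hk : 1 ≤ k := by omega
  have hppos := hp.pos
  obtain ⟨ι, hι⟩ := ZMod.exists_injective_addMonoidHom_pow hp.ne_zero (m := m) (by omega)
  have hinj := eq_zero_of_periodic_polyFunctions hι hk
  let G := shearGroup (polyFunctions ι k) (translate_mem_polyFunctions ι k)
  let N := (shearTranslation (polyFunctions ι k) (translate_mem_polyFunctions ι k)).ker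
  let e : Multiplicative (ZMod (p ^ m)) ≃* Subgroup.center G :=
    centerShearGroupEquiv hinj (const_mem_polyFunctions ι k)
  have hcardG : Nat.card G = p ^ (m + 1 + k) := by
    rw [card_shearGroup, card_polyFunctions hι (by rw [Nat.card_zmod]; omega), Nat.card_zmod,
      Nat.card_zmod]
    ring
  have hcardZ : Nat.card (Subgroup.center G) = p ^ m :=
    (Nat.card_congr e.toEquiv).symm.trans (Nat.card_zmod _)
  have hG : IsPGroup p G := IsPGroup.of_card hcardG
  have hcyc : IsCyclic (Subgroup.center G) := isCyclic_of_surjective e e.surjective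
  have hindex : N.index = p := index_ker_shearTranslation.trans (Nat.card_zmod p)
  have hcardN : Nat.card N = p ^ (m + k) := by
    have := N.card_mul_index
    rw [hindex, hcardG, show m + 1 + k = m + k + 1 by ring, pow_succ] at this
    exact Nat.eq_of_mul_eq_mul_right hppos this
  have : Nontrivial G := Finite.one_lt_card_iff_nontrivial.1
    (hcardG ▸ Nat.one_lt_pow (by omega) hp.one_lt)
  have hZN : Subgroup.center G ≤ N := fun σ hσ => by
    obtain ⟨c, hc⟩ := (mem_center_shearGroup_iff hinj).1 hσ
    exact mem_ker_shearTranslation.2 ⟨_, const_mem_polyFunctions ι k c, hc⟩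
  have hcore : ∀ H : Subgroup G, Disjoint H (Subgroup.center G) → Nat.card H ≤ p ^ k :=
    fun H hH => by
      rcases hG.card_le_or_card_mul_card_center_le N
        (fun _ ha _ hb => commute_of_mem_ker_shearTranslation ha hb) hindex hZN H hH with h | h
      · exact h.trans (Nat.le_self_pow (by omega) p)
      · rw [hcardZ, hcardN, pow_add, mul_comm] at h
        exact Nat.le_of_mul_le_mul_left h (by positivity)
  refine ⟨G, inferInstance, inferInstance, hcardG, fun hcomm => ?_, hcyc, le_antisymm ?_ ?_⟩
  · have htop : Subgroup.center G = ⊤ :=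
      eq_top_iff.2 fun σ _ => Subgroup.mem_center_iff.2 fun τ => hcomm τ σ
    rw [← Subgroup.card_eq_iff_eq_top, hcardZ, hcardG] at htop
    have := Nat.pow_right_injective hp.two_le htop
    omega
  · let f : ZMod p × ZMod (p ^ m) ≃ Fin (p ^ (m + 1)) :=
      Finite.equivFinOfCardEq (by rw [Nat.card_prod, Nat.card_zmod, Nat.card_zmod]; ring)
    exact Nat.sInf_le ⟨f.permCongrHom.toMonoidHom.comp G.subtype,
      f.permCongrHom.injective.comp G.subtype_injective⟩
  · refine le_csInf ⟨Nat.card G, ?_⟩ ?_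
    · exact ⟨(Finite.equivFin G).permCongrHom.toMonoidHom.comp (MulAction.toPermHom G G),
        (Finite.equivFin G).permCongrHom.injective.comp MulAction.toPerm_injective⟩
    · rintro N ⟨f, hf⟩
      obtain ⟨H, hd, hH⟩ := hG.exists_disjoint_center_index_le f hf
      refine le_trans ?_ hH
      refine Nat.le_of_mul_le_mul_left ?_ (Nat.pow_pos hppos : 0 < p ^ k)
      calc p ^ k * p ^ (m + 1) = Nat.card H * H.index := by
            rw [H.card_mul_index, hcardG, ← pow_add, add_comm]
        _ ≤ p ^ k * H.index := Nat.mul_le_mul_right _ (hcore H hd)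
end

section
/- Let G be a finite non-abelian p-group with exp(G) = p, character degree set cd(G) = {1, p^s} with s > 1, and d(Z(G) ∩ G') = d(Z(G)). Then c(G) = d(Z(G))·p^{s+1}, where c(G) is the minimal degree of a faithful quasi-permutation representation of G over ℂ. -/
open FDRep CategoryTheory Subgroup

section Weights

variable {p : ℕ} [Fact p.Prime] {A : Type*} [AddCommGroup A] [Finite A] [Module (ZMod p) A]
  {V : Type*} [AddCommGroup V] [Module ℂ V]

theorem card_dual_zmod : Nat.card (Module.Dual (ZMod p) A) = Nat.card A := by
  have : Module.Finite (ZMod p) A := Module.Finite.of_finite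
  rw [Module.natCard_eq_pow_finrank (K := ZMod p) (V := A),
    Module.natCard_eq_pow_finrank (K := ZMod p), Subspace.dual_finrank_eq]

instance finite_dual_zmod : Finite (Module.Dual (ZMod p) A) :=
  Finite.of_injective (fun a : Module.Dual (ZMod p) A => (a : A → ZMod p)) DFunLike.coe_injective

theorem sum_dual_stdAddChar [Fintype (Module.Dual (ZMod p) A)] [DecidableEq A] (x : A) :
    ∑ a : Module.Dual (ZMod p) A, ZMod.stdAddChar (-(a x)) =
      if x = 0 then (Nat.card A : ℂ) else 0 := by
  split_ifs with hx
  · rw [← card_dual_zmod (p := p)]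
    simp [hx, Nat.card_eq_fintype_card]
  · obtain ⟨a, ha⟩ : ∃ a : Module.Dual (ZMod p) A, a x ≠ 0 := by
      by_contra! h
      exact hx ((Module.forall_dual_apply_eq_zero_iff (ZMod p) x).1 h)
    let χ : AddChar (Module.Dual (ZMod p) A) ℂ :=
      (ZMod.stdAddChar (N := p)).compAddMonoidHom
        (-(Module.Dual.eval (ZMod p) A x).toAddMonoidHom)
    have hχ : χ ≠ 0 := by
      intro h
      have h1 : χ a = 1 := by rw [h]; rfl
      have h2 : ZMod.stdAddChar (-(a x)) = (1 : ℂ) := h1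
      rw [← AddChar.map_zero_eq_one (ZMod.stdAddChar (N := p))] at h2
      exact ha (neg_eq_zero.1 (ZMod.injective_stdAddChar h2))
    exact AddChar.sum_eq_zero_iff_ne_zero.2 hχ

/-- The projection onto the weight space of weight `a` of a representation of an elementary
abelian `p`-group. -/
noncomputable def weightProj (τ : Multiplicative A →* Module.End ℂ V)
    (a : Module.Dual (ZMod p) A) : Module.End ℂ V :=
  (Nat.card A : ℂ)⁻¹ • ∑ᶠ x : A, (ZMod.stdAddChar (-(a x)) : ℂ) • τ (Multiplicative.ofAdd x)

variable (τ : Multiplicative A →* Module.End ℂ V) (a : Module.Dual (ZMod p) A)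

theorem weightProj_eq_sum [Fintype A] : weightProj τ a =
    (Nat.card A : ℂ)⁻¹ • ∑ x : A, (ZMod.stdAddChar (-(a x)) : ℂ) • τ (Multiplicative.ofAdd x) := by
  rw [weightProj, finsum_eq_sum_of_fintype]

theorem mul_weightProj (y : A) :
    τ (Multiplicative.ofAdd y) * weightProj τ a = (ZMod.stdAddChar (a y) : ℂ) • weightProj τ a := by
  cases nonempty_fintype A
  have key : ∑ x : A, (ZMod.stdAddChar (-(a x)) : ℂ) • τ (Multiplicative.ofAdd (y + x)) =
      (ZMod.stdAddChar (a y) : ℂ) •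
        ∑ x : A, (ZMod.stdAddChar (-(a x)) : ℂ) • τ (Multiplicative.ofAdd x) := by
    rw [← Equiv.sum_comp (Equiv.addLeft y)
      (fun x => (ZMod.stdAddChar (-(a x)) : ℂ) • τ (Multiplicative.ofAdd x)), Finset.smul_sum]
    refine Finset.sum_congr rfl fun x _ => ?_
    rw [smul_smul, ← AddChar.map_add_eq_mul]
    simp
  rw [weightProj_eq_sum, mul_smul_comm, Finset.mul_sum, smul_comm, ← key]
  simp_rw [mul_smul_comm, ← map_mul, ← ofAdd_add]

theorem weightProj_isIdempotentElem : IsIdempotentElem (weightProj τ a) := by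
  cases nonempty_fintype A
  have h0 : (Nat.card A : ℂ) ≠ 0 := Nat.cast_ne_zero.2 Nat.card_pos.ne'
  rw [IsIdempotentElem]
  nth_rewrite 1 [weightProj_eq_sum]
  rw [smul_mul_assoc, Finset.sum_mul]
  simp_rw [smul_mul_assoc, mul_weightProj, smul_smul, ← AddChar.map_add_eq_mul]
  simp only [neg_add_cancel, AddChar.map_zero_eq_one, one_smul, Finset.sum_const, Finset.card_univ,
    ← Nat.card_eq_fintype_card]
  rw [← Nat.cast_smul_eq_nsmul ℂ, smul_smul, inv_mul_cancel₀ h0, one_smul]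

theorem sum_weightProj [Fintype (Module.Dual (ZMod p) A)] :
    ∑ a : Module.Dual (ZMod p) A, weightProj τ a = 1 := by
  classical
  cases nonempty_fintype A
  have h0 : (Nat.card A : ℂ) ≠ 0 := Nat.cast_ne_zero.2 Nat.card_pos.ne'
  simp_rw [weightProj_eq_sum]
  rw [← Finset.smul_sum, Finset.sum_comm]
  simp_rw [← Finset.sum_smul, sum_dual_stdAddChar, ite_smul, zero_smul]
  simp [smul_smul]

theorem commute_weightProj {f : Module.End ℂ V} (hf : ∀ x, Commute f (τ x)) :
    Commute f (weightProj τ a) := by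
  cases nonempty_fintype A
  rw [weightProj_eq_sum]
  exact (Commute.sum_right _ _ _ fun x _ => (hf _).smul_right _).smul_right _

theorem apply_of_mem_range_weightProj {v : V} (hv : v ∈ LinearMap.range (weightProj τ a)) (y : A) :
    τ (Multiplicative.ofAdd y) v = (ZMod.stdAddChar (a y) : ℂ) • v := by
  obtain ⟨w, rfl⟩ := hv
  exact LinearMap.congr_fun (mul_weightProj τ a y) w

theorem trace_weight [FiniteDimensional ℂ V] [Fintype (Module.Dual (ZMod p) A)] (y : A) :
    LinearMap.trace ℂ V (τ (Multiplicative.ofAdd y)) = ∑ a : Module.Dual (ZMod p) A,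
      (ZMod.stdAddChar (a y) : ℂ) * Module.finrank ℂ (LinearMap.range (weightProj τ a)) := by
  conv_lhs => rw [← mul_one (τ _), ← sum_weightProj (p := p) τ, Finset.mul_sum, map_sum]
  refine Finset.sum_congr rfl fun a _ => ?_
  rw [mul_weightProj, map_smul, smul_eq_mul,
    (LinearMap.IsIdempotentElem.isProj_range _ (weightProj_isIdempotentElem τ a)).trace]

theorem finrank_eq_sum_weight [FiniteDimensional ℂ V] [Fintype (Module.Dual (ZMod p) A)] :
    Module.finrank ℂ V = ∑ a : Module.Dual (ZMod p) A,
      Module.finrank ℂ (LinearMap.range (weightProj τ a)) := by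
  have h := trace_weight (p := p) τ 0
  simp only [ofAdd_zero, map_one, map_zero, AddChar.map_zero_eq_one, one_mul,
    LinearMap.trace_one] at h
  exact_mod_cast h

theorem exists_basis_weights (hτ : Function.Injective τ) :
    ∃ b : Module.Basis (Fin (Module.finrank (ZMod p) A)) (ZMod p) (Module.Dual (ZMod p) A),
      ∀ i, LinearMap.range (weightProj τ (b i)) ≠ ⊥ := by
  have : Module.Finite (ZMod p) A := Module.Finite.of_finite
  have := Fintype.ofFinite (Module.Dual (ZMod p) A)
  let S : Set (Module.Dual (ZMod p) A) := {a | LinearMap.range (weightProj τ a) ≠ ⊥}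
  have hS : Submodule.span (ZMod p) S = ⊤ := by
    rw [← Subspace.dualCoannihilator_dualAnnihilator_eq (W := Submodule.span (ZMod p) S)]
    suffices (Submodule.span (ZMod p) S).dualCoannihilator = ⊥ by simp [this]
    rw [eq_bot_iff]
    intro x hx
    rw [Submodule.mem_dualCoannihilator] at hx
    have h1 : τ (Multiplicative.ofAdd x) = 1 := by
      rw [← mul_one (τ _), ← sum_weightProj (p := p) τ, Finset.mul_sum]
      refine Finset.sum_congr rfl fun a _ => ?_
      rw [mul_weightProj]
      by_cases ha : a ∈ S
      · rw [hx a (Submodule.subset_span ha), AddChar.map_zero_eq_one, one_smul]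
      · have : weightProj τ a = 0 := LinearMap.range_eq_bot.1 (not_not.1 ha)
        rw [this, smul_zero]
    exact Multiplicative.ofAdd.injective (hτ (h1.trans (map_one τ).symm))
  obtain ⟨B, hBS, hB, hli⟩ := exists_linearIndependent (ZMod p) S
  let b := Module.Basis.mk hli (by simp [hB, hS])
  have hB' : Finite B := inferInstance
  have : Fintype B := Fintype.ofFinite B
  have hcard : Fintype.card B = Module.finrank (ZMod p) A := by
    rw [← Subspace.dual_finrank_eq, Module.finrank_eq_card_basis b]
  refine ⟨b.reindex (Fintype.equivFinOfCardEq hcard), fun i => ?_⟩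
  rw [Module.Basis.reindex_apply, Module.Basis.mk_apply]
  exact hBS (Subtype.prop _)

end Weights

theorem closure_eq_top_iff_span_zmod {p : ℕ} {H : Type*} [CommGroup H]
    [Module (ZMod p) (Additive H)] (S : Set H) :
    Subgroup.closure S = ⊤ ↔ Submodule.span (ZMod p) (Additive.ofMul '' S) = ⊤ := by
  constructor
  · intro h
    rw [eq_top_iff]
    intro x _
    have hx : (Additive.toMul x : H) ∈ Subgroup.closure S := h ▸ Subgroup.mem_top _
    refine Subgroup.closure_induction
      (p := fun y _ => Additive.ofMul y ∈ Submodule.span (ZMod p) (Additive.ofMul '' S))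
      (fun y hy => Submodule.subset_span ⟨y, hy, rfl⟩) (Submodule.zero_mem _)
      (fun _ _ _ _ h1 h2 => Submodule.add_mem _ h1 h2) (fun _ _ h1 => Submodule.neg_mem _ h1) hx
  · intro h
    rw [eq_top_iff]
    intro x _
    have hle : Submodule.span (ZMod p) (Additive.ofMul '' S) ≤
        AddSubgroup.toZModSubmodule p (Subgroup.toAddSubgroup (G := H) (Subgroup.closure S)) := by
      rw [Submodule.span_le]
      rintro _ ⟨y, hy, rfl⟩
      exact Subgroup.subset_closure (G := H) hy
    exact hle (h ▸ Submodule.mem_top : Additive.ofMul x ∈ _)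

theorem minGens_eq_finrank_zmod {p : ℕ} [Fact p.Prime] {H : Type*} [CommGroup H] [Finite H]
    [Module (ZMod p) (Additive H)] :
    minGens H = Module.finrank (ZMod p) (Additive H) := by
  classical
  have : Module.Finite (ZMod p) (Additive H) := Module.Finite.of_finite
  apply le_antisymm
  · let b := Module.finBasis (ZMod p) (Additive H)
    refine Nat.sInf_le ⟨Finset.univ.image (Additive.toMul ∘ b), ?_, ?_⟩
    · rw [Finset.card_image_of_injective _ (Additive.toMul.injective.comp b.injective),
        Finset.card_univ, Fintype.card_fin]
    · rw [closure_eq_top_iff_span_zmod (p := p), ← b.span_eq]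
      congr 1
      ext x
      simp
  · refine le_csInf ⟨_, (Set.toFinite (Set.univ : Set H)).toFinset, rfl, by simp⟩ ?_
    rintro n ⟨S, rfl, hS⟩
    rw [closure_eq_top_iff_span_zmod (p := p)] at hS
    have h := finrank_span_finset_le_card (R := ZMod p) (S.image Additive.ofMul)
    rw [Set.finrank, Finset.coe_image, hS, finrank_top] at h
    exact h.trans Finset.card_image_le

theorem card_eq_pow_minGens_of_module {p : ℕ} [Fact p.Prime] {H : Type*} [CommGroup H] [Finite H]
    [Module (ZMod p) (Additive H)] : Nat.card H = p ^ minGens H := by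
  have h := Module.natCard_eq_pow_finrank (K := ZMod p) (V := Additive H)
  rw [Nat.card_zmod, ← minGens_eq_finrank_zmod] at h
  exact h

open scoped IsMulCommutative in
theorem card_eq_pow_minGens {p : ℕ} [Fact p.Prime] {H : Type*} [Group H] [IsMulCommutative H]
    [Finite H] (hexp : ∀ x : H, x ^ p = 1) : Nat.card H = p ^ minGens H := by
  let : Module (ZMod p) (Additive H) := AddCommGroup.zmodModule fun x => hexp x
  exact card_eq_pow_minGens_of_module

theorem center_le_commutator_of_minGens {G : Type*} [Group G] [Finite G] {p : ℕ} [Fact p.Prime]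
    (hexp : ∀ g : G, g ^ p = 1)
    (hd : minGens ↥(Subgroup.center G ⊓ commutator G) = minGens ↥(Subgroup.center G)) :
    Subgroup.center G ≤ commutator G := by
  have : IsMulCommutative ↥(Subgroup.center G ⊓ commutator G) :=
    ⟨⟨fun a b => Subtype.ext ((Subgroup.mem_center_iff.1 a.2.1 b).symm)⟩⟩
  have h1 := card_eq_pow_minGens (H := ↥(Subgroup.center G)) fun x => Subtype.ext (hexp x)
  have h2 := card_eq_pow_minGens (H := ↥(Subgroup.center G ⊓ commutator G))
    fun x => Subtype.ext (hexp x)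
  rw [hd, ← h1] at h2
  exact inf_eq_left.1 (Subgroup.eq_of_le_of_card_ge inf_le_left h2.ge)

section Irreducible

variable {G V : Type} [Group G] [AddCommGroup V] [Module ℂ V] [FiniteDimensional ℂ V]

theorem simple_fdRep_of_forall_invariant [Finite G] [Nontrivial V] (ρ : Representation ℂ G V)
    (h : ∀ U : Submodule ℂ V, (∀ g, U ∈ Module.End.invtSubmodule (ρ g)) → U = ⊥ ∨ U = ⊤) :
    Simple (FDRep.of ρ) := by
  rw [simple_iff_end_is_rank_one]
  have hne : (𝟙 (FDRep.of ρ) : FDRep.of ρ ⟶ FDRep.of ρ) ≠ 0 := by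
    intro h0
    obtain ⟨v, hv⟩ := exists_ne (0 : V)
    apply hv
    have := congrArg (fun f : FDRep.of ρ ⟶ FDRep.of ρ => f.hom.hom.hom v) h0
    exact this
  rw [finrank_eq_one_iff_of_nonzero' _ hne]
  intro f
  let F : Module.End ℂ V := f.hom.hom.hom
  have hF : ∀ g, Commute F (ρ g) := by
    intro g
    have h1 := f.comm g
    have h2 := congrArg (fun f => f.hom.hom) h1
    exact h2
  obtain ⟨c, hc⟩ := Module.End.exists_eigenvalue F
  refine ⟨c, ?_⟩
  have htop : F.eigenspace c = ⊤ := by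
    refine (h _ fun g => ?_).resolve_left hc
    rw [Module.End.mem_invtSubmodule]
    intro v hv
    rw [Submodule.mem_comap, Module.End.mem_eigenspace_iff]
    rw [Module.End.mem_eigenspace_iff] at hv
    have := LinearMap.congr_fun (hF g) v
    simp only [Module.End.mul_apply] at this
    rw [this, hv, map_smul]
  ext v
  have hv : v ∈ F.eigenspace c := htop ▸ Submodule.mem_top
  exact (Module.End.mem_eigenspace_iff.1 hv).symm

theorem exists_invariant_finrank_mem_cdSet [Finite G] (ρ : Representation ℂ G V)
    {U : Submodule ℂ V} (hU : U ≠ ⊥) (hinv : ∀ g, U ∈ Module.End.invtSubmodule (ρ g)) :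
    ∃ W ≤ U, (∀ g, W ∈ Module.End.invtSubmodule (ρ g)) ∧ Module.finrank ℂ W ∈ cdSet G := by
  obtain ⟨W, ⟨hWU, hW0, hW⟩, hmin⟩ := (wellFounded_lt (α := Submodule ℂ V)).has_min
    {W | W ≤ U ∧ W ≠ ⊥ ∧ ∀ g, W ∈ Module.End.invtSubmodule (ρ g)} ⟨U, le_rfl, hU, hinv⟩
  refine ⟨W, hWU, hW, ?_⟩
  have : Nontrivial W := Submodule.nontrivial_iff_ne_bot.2 hW0
  let σ : Representation ℂ G W := Subrepresentation.toRepresentation ⟨W, fun g v hv => hW g hv⟩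
  refine ⟨FDRep.of σ, simple_fdRep_of_forall_invariant σ fun Y hY => ?_, rfl⟩
  by_contra! hne
  refine hmin (Y.map W.subtype) ⟨(Submodule.map_subtype_le W Y).trans hWU, ?_, ?_⟩ ?_
  · exact fun h => hne.1 (Submodule.map_injective_of_injective W.injective_subtype
      (h.trans (Submodule.map_bot _).symm))
  · rintro g _ ⟨y, hy, rfl⟩
    exact ⟨σ g y, hY g hy, rfl⟩
  · refine lt_of_le_of_ne (Submodule.map_subtype_le W Y) fun h => hne.2 ?_
    exact Submodule.map_injective_of_injective W.injective_subtype
      (h.trans (Submodule.map_subtype_top W).symm)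

theorem exists_invariant_finrank_eq [Finite G] {m : ℕ} (hcd : cdSet G = {1, m})
    (ρ : Representation ℂ G V) {U : Submodule ℂ V} (hU : U ≠ ⊥)
    (hinv : ∀ g, U ∈ Module.End.invtSubmodule (ρ g)) {z : G} (hz : z ∈ commutator G) {c : ℂ} (hc : c ≠ 1)
    (hzU : ∀ v ∈ U, ρ z v = c • v) :
    ∃ W ≤ U, (∀ g, W ∈ Module.End.invtSubmodule (ρ g)) ∧ Module.finrank ℂ W = m := by
  obtain ⟨W, hWU, hW, hmem⟩ := exists_invariant_finrank_mem_cdSet ρ hU hinv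
  refine ⟨W, hWU, hW, ?_⟩
  rw [hcd] at hmem
  refine hmem.resolve_left fun h1 => hc ?_
  let σ : Representation ℂ G W := Subrepresentation.toRepresentation ⟨W, fun g v hv => hW g hv⟩
  have hσ : σ z = c • 1 := by
    ext v
    exact hzU v (hWU v.2)
  let δ : G →* ℂˣ := (LinearMap.det.comp σ).toHomUnits
  have hδ : δ z = 1 := Abelianization.commutator_subset_ker δ hz
  have hdet : LinearMap.det (σ z) = 1 := congrArg Units.val hδ
  rw [hσ, LinearMap.det_smul, h1, pow_one, map_one, mul_one] at hdet
  exact hdet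

end Irreducible

theorem exists_ringEquiv_extends {K C : Type*} [Field K] [Field C] [IsAlgClosed C] [Algebra K C]
    (σ : K ≃+* K) : ∃ τ : C ≃+* C, ∀ x, τ (algebraMap K C x) = algebraMap K C (σ x) := by
  obtain ⟨ι, v, hv⟩ := exists_isTranscendenceBasis' K C
  have := IsAlgClosed.isAlgClosure_of_transcendence_basis v hv
  let e : Algebra.adjoin K (Set.range v) ≃+* Algebra.adjoin K (Set.range v) :=
    (hv.1.aevalEquiv.symm.toRingEquiv.trans (MvPolynomial.mapEquiv ι σ)).trans
      hv.1.aevalEquiv.toRingEquiv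
  refine ⟨IsAlgClosure.equivOfEquiv C C e, fun x => ?_⟩
  have h := IsAlgClosure.equivOfEquiv_algebraMap C C e
    (algebraMap K (Algebra.adjoin K (Set.range v)) x)
  have he : e (algebraMap K _ x) = algebraMap K _ (σ x) := by
    simp only [e, RingEquiv.trans_apply]
    change hv.1.aevalEquiv (MvPolynomial.mapEquiv ι σ (hv.1.aevalEquiv.symm (algebraMap K _ x))) = _
    rw [AlgEquiv.commutes, MvPolynomial.algebraMap_eq, MvPolynomial.mapEquiv_apply,
      MvPolynomial.map_C, ← MvPolynomial.algebraMap_eq]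
    exact AlgEquiv.commutes _ _
  rw [he] at h
  exact h

theorem exists_ringEquiv_stdAddChar {p : ℕ} [Fact p.Prime] {k : ZMod p} (hk : k ≠ 0) :
    ∃ σ : ℂ ≃+* ℂ, ∀ j : ZMod p, σ (ZMod.stdAddChar j) = ZMod.stdAddChar (k * j) := by
  let K := CyclotomicField p ℚ
  have : NeZero p := ⟨(Fact.out : p.Prime).ne_zero⟩
  have : IsCyclotomicExtension {p} ℚ K := CyclotomicField.isCyclotomicExtension p ℚ
  let : Algebra K ℂ := (IsAlgClosed.lift (R := ℚ) (S := K) (M := ℂ)).toRingHom.toAlgebra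
  obtain ⟨σ, hσ⟩ := exists_ringEquiv_extends (C := ℂ)
    ((IsCyclotomicExtension.Rat.galEquivZMod p K).symm (Units.mk0 k hk)).toRingEquiv
  refine ⟨σ, fun j => ?_⟩
  have hζ := (IsCyclotomicExtension.zeta_spec p ℚ K).map_of_injective
    (algebraMap K ℂ).injective
  have hj : (ZMod.stdAddChar j : ℂ) ^ p = 1 := by
    rw [← AddChar.map_nsmul_eq_pow]; simp
  obtain ⟨i, -, hi⟩ := hζ.eq_pow_of_pow_eq_one hj
  rw [← map_pow] at hi
  have hx : (IsCyclotomicExtension.zeta p ℚ K ^ i) ^ p = 1 := by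
    rw [← pow_mul, mul_comm, pow_mul, (IsCyclotomicExtension.zeta_spec p ℚ K).pow_eq_one, one_pow]
  rw [← hi, hσ]
  have h := IsCyclotomicExtension.Rat.galEquivZMod_apply_of_pow_eq p K
    ((IsCyclotomicExtension.Rat.galEquivZMod p K).symm (Units.mk0 k hk)) hx
  rw [MulEquiv.apply_symm_apply] at h
  refine (congrArg (algebraMap K ℂ) h).trans ?_
  rw [map_pow, hi, ← AddChar.map_nsmul_eq_pow, Units.val_mk0, nsmul_eq_mul, ZMod.natCast_val,
    ZMod.cast_id]

theorem sum_stdAddChar_mul {p : ℕ} [Fact p.Prime] (j : ZMod p) :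
    ∑ k : ZMod p, ZMod.stdAddChar (k * j) = if j = 0 then (p : ℂ) else 0 := by
  have h := AddChar.sum_mulShift j (ZMod.isPrimitive_stdAddChar p)
  simpa [ZMod.card] using h

theorem sum_eq_of_sum_stdAddChar_eq {p : ℕ} [Fact p.Prime] {c : ZMod p → ℕ} {m : ℕ}
    (h : ∑ j, ZMod.stdAddChar j * (c j : ℂ) = m) : ∑ j, c j = p * c 1 + m := by
  have hk : ∀ k : ZMod p, ∑ j, ZMod.stdAddChar (k * j) * (c j : ℂ) =
      m + if k = 0 then ((∑ j, c j : ℕ) : ℂ) - m else 0 := by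
    intro k
    split_ifs with hk
    · simp [hk]
    · obtain ⟨σ, hσ⟩ := exists_ringEquiv_stdAddChar hk
      have := congrArg σ h
      simpa [hσ] using this
  have h1 : ∑ k : ZMod p, ZMod.stdAddChar (k * (-1)) *
      ∑ j, ZMod.stdAddChar (k * j) * (c j : ℂ) = p * c 1 := by
    simp_rw [Finset.mul_sum]
    rw [Finset.sum_comm]
    simp_rw [← mul_assoc, ← AddChar.map_add_eq_mul, ← mul_add, ← Finset.sum_mul,
      sum_stdAddChar_mul, neg_add_eq_zero, ite_mul, zero_mul]
    simp
  simp_rw [hk, mul_add] at h1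
  rw [Finset.sum_add_distrib, ← Finset.sum_mul, sum_stdAddChar_mul] at h1
  simp at h1
  have : ((∑ j, c j : ℕ) : ℂ) = p * c 1 + m := by
    push_cast
    linear_combination h1
  exact_mod_cast this

section Multiplicities

variable {p : ℕ} [Fact p.Prime] {A : Type*} [AddCommGroup A] [Finite A] [Module (ZMod p) A]
  {V : Type*} [AddCommGroup V] [Module ℂ V] [FiniteDimensional ℂ V]

theorem exists_weight_multiplicities (τ : Multiplicative A →* Module.End ℂ V) (y : A) :
    ∃ c : ZMod p → ℕ,
      LinearMap.trace ℂ V (τ (Multiplicative.ofAdd y)) = ∑ j, ZMod.stdAddChar j * (c j : ℂ) ∧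
      Module.finrank ℂ V = ∑ j, c j ∧
      ∀ (S : Finset (Module.Dual (ZMod p) A)) (j : ZMod p), (∀ a ∈ S, a y = j) →
        ∑ a ∈ S, Module.finrank ℂ (LinearMap.range (weightProj τ a)) ≤ c j := by
  classical
  have := Fintype.ofFinite (Module.Dual (ZMod p) A)
  refine ⟨fun j => ∑ a : Module.Dual (ZMod p) A with a y = j,
    Module.finrank ℂ (LinearMap.range (weightProj τ a)), ?_, ?_, ?_⟩
  · rw [trace_weight (p := p), ← Finset.sum_fiberwise Finset.univ
      (fun a : Module.Dual (ZMod p) A => a y)]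
    refine Finset.sum_congr rfl fun j _ => ?_
    push_cast
    rw [Finset.mul_sum]
    refine Finset.sum_congr rfl fun a ha => ?_
    rw [(Finset.mem_filter.1 ha).2]
  · rw [finrank_eq_sum_weight (p := p) τ, Finset.sum_fiberwise]
  · intro S j hS
    exact Finset.sum_le_sum_of_subset fun a ha => Finset.mem_filter.2 ⟨Finset.mem_univ _, hS a ha⟩

theorem exists_eigenvalue_multiplicities {f : Module.End ℂ V} (hf : f ^ p = 1) :
    ∃ c : ZMod p → ℕ, LinearMap.trace ℂ V f = ∑ j, ZMod.stdAddChar j * (c j : ℂ) ∧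
      Module.finrank ℂ V = ∑ j, c j := by
  have : Fact (1 < p) := ⟨(Fact.out : p.Prime).one_lt⟩
  let τ : Multiplicative (ZMod p) →* Module.End ℂ V :=
    { toFun := fun x => f ^ (Multiplicative.toAdd x).val
      map_one' := by simp
      map_mul' := fun x y => by
        rw [toAdd_mul, ZMod.val_add, ← pow_eq_pow_mod _ hf, pow_add] }
  obtain ⟨c, h1, h2, -⟩ := exists_weight_multiplicities (p := p) τ 1
  refine ⟨c, ?_, h2⟩
  rw [← h1]
  simp [τ, ZMod.val_one]

end Multiplicities

section Center

open scoped IsMulCommutative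

variable {p : ℕ} [Fact p.Prime] {G V : Type} [Group G] [Finite G] [AddCommGroup V] [Module ℂ V]
  [FiniteDimensional ℂ V]

/-- The restriction of a representation to the center, written additively. -/
def centerRep (ρ : Representation ℂ G V) :
    Multiplicative (Additive ↥(Subgroup.center G)) →* Module.End ℂ V where
  toFun x := ρ (Additive.toMul (Multiplicative.toAdd x) : ↥(Subgroup.center G))
  map_one' := map_one ρ
  map_mul' _ _ := map_mul ρ _ _

variable [Module (ZMod p) (Additive ↥(Subgroup.center G))]

theorem exists_basis_invariant (hZ : Subgroup.center G ≤ commutator G) {m : ℕ}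
    (hcd : cdSet G = {1, m}) (ρ : Representation ℂ G V) (hρ : Function.Injective ρ) :
    ∃ b : Module.Basis (Fin (minGens ↥(Subgroup.center G))) (ZMod p)
        (Module.Dual (ZMod p) (Additive ↥(Subgroup.center G))),
      ∀ i, ∃ W ≤ LinearMap.range (weightProj (centerRep ρ) (b i)),
        (∀ g, W ∈ Module.End.invtSubmodule (ρ g)) ∧ Module.finrank ℂ W = m := by
  rw [minGens_eq_finrank_zmod (p := p)]
  have hinj : Function.Injective (centerRep ρ) := fun x y h => Subtype.ext (hρ h)
  obtain ⟨b, hb⟩ := exists_basis_weights (p := p) (centerRep ρ) hinj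
  refine ⟨b, fun i => ?_⟩
  obtain ⟨y, hy⟩ : ∃ y, b i y ≠ 0 := by
    by_contra! h
    exact b.ne_zero i (LinearMap.ext h)
  refine exists_invariant_finrank_eq hcd ρ (hb i) (fun g => ?_)
    (z := (Additive.toMul y : ↥(Subgroup.center G))) (hZ (Subtype.prop _))
    (c := ZMod.stdAddChar (b i y)) ?_
    (fun v hv => apply_of_mem_range_weightProj (centerRep ρ) (b i) hv y)
  · have hcomm : Commute (ρ g) (weightProj (centerRep ρ) (b i)) :=
      commute_weightProj _ _ fun x => by
        have := Subgroup.mem_center_iff.1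
          (Additive.toMul (Multiplicative.toAdd x) : ↥(Subgroup.center G)).2 g
        change ρ _ * ρ _ = ρ _ * ρ _
        rw [← map_mul, ← map_mul, this]
    rintro _ ⟨v, rfl⟩
    exact ⟨ρ g v, (LinearMap.congr_fun hcomm v).symm⟩
  · rw [← AddChar.map_zero_eq_one (ZMod.stdAddChar (N := p))]
    exact fun h => hy (ZMod.injective_stdAddChar h)

theorem le_finrank_of_trace (hZ : Subgroup.center G ≤ commutator G) {m : ℕ}
    (hcd : cdSet G = {1, m}) (ρ : Representation ℂ G V) (hρ : Function.Injective ρ)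
    (htr : ∀ g, ∃ t : ℕ, LinearMap.trace ℂ V (ρ g) = t) :
    p * (minGens ↥(Subgroup.center G) * m) ≤ Module.finrank ℂ V := by
  classical
  obtain ⟨b, hb⟩ := exists_basis_invariant (p := p) hZ hcd ρ hρ
  have : Module.Finite (ZMod p) (Additive ↥(Subgroup.center G)) := Module.Finite.of_finite
  let z := (Module.evalEquiv (ZMod p) (Additive ↥(Subgroup.center G))).symm
    (b.constr (ZMod p) fun _ => 1)
  have hz : ∀ i, b i z = 1 := by
    intro i
    rw [Module.apply_evalEquiv_symm_apply, b.constr_basis]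
  obtain ⟨c, h1, h2, h3⟩ := exists_weight_multiplicities (p := p) (centerRep ρ) z
  obtain ⟨t, ht⟩ := htr (Additive.toMul z : ↥(Subgroup.center G))
  have h4 := sum_eq_of_sum_stdAddChar_eq (h1.symm.trans ht)
  have h5 := h3 (Finset.univ.image b) 1 (by simp [hz])
  rw [Finset.sum_image (fun i _ j _ h => b.injective h)] at h5
  have h6 : ∀ i ∈ Finset.univ, m ≤
      Module.finrank ℂ (LinearMap.range (weightProj (centerRep ρ) (b i))) := by
    intro i _
    obtain ⟨W, hW, -, rfl⟩ := hb i
    exact Submodule.finrank_mono hW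
  have h7 := Finset.card_nsmul_le_sum _ _ _ h6
  rw [Finset.card_univ, Fintype.card_fin, smul_eq_mul] at h7
  rw [h2, h4]
  exact (Nat.mul_le_mul_left p (h7.trans h5)).trans (Nat.le_add_right _ _)

end Center

section Upper

variable {G : Type} [Group G]

theorem IsPGroup.eq_bot_of_normal_of_inf_center_eq_bot [Finite G] {p : ℕ} [Fact p.Prime]
    (hG : IsPGroup p G) {K : Subgroup G} [K.Normal] (hK : K ⊓ Subgroup.center G = ⊥) : K = ⊥ := by
  by_contra hne
  have hKp : IsPGroup p K := hG.to_subgroup K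
  have : Nontrivial K := (Subgroup.nontrivial_iff_ne_bot K).2 hne
  have hdvd : p ∣ Nat.card K := by
    obtain ⟨n, hn0, hn⟩ := hKp.nontrivial_iff_card.1 inferInstance
    exact hn ▸ dvd_pow_self p hn0.ne'
  obtain ⟨x, hx, hx1⟩ := (hG.of_equiv ConjAct.toConjAct)
    |>.exists_fixed_point_of_prime_dvd_card_of_fixed_point K hdvd (a := 1)
      (fun g => by ext; simp)
  apply hx1
  have hxc : (x : G) ∈ Subgroup.center G := by
    rw [Subgroup.mem_center_iff]
    intro g
    have h := congrArg Subtype.val (hx (ConjAct.toConjAct g))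
    rw [ConjAct.Subgroup.val_conj_smul, ConjAct.toConjAct_smul] at h
    exact mul_inv_eq_iff_eq_mul.1 h
  have : (x : G) ∈ K ⊓ Subgroup.center G := ⟨x.2, hxc⟩
  rw [hK] at this
  exact (Subtype.ext (Subgroup.mem_bot.1 this)).symm

theorem exists_generalLinearGroup_of_matrix {κ : Type*} [Fintype κ] [DecidableEq κ]
    (P : G →* Matrix κ κ ℂ) (hP : Function.Injective P) (htr : ∀ g, ∃ t : ℕ, (P g).trace = t) :
    ∃ ρ : G →* Matrix.GeneralLinearGroup (Fin (Fintype.card κ)) ℂ, Function.Injective ρ ∧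
      ∀ g : G, ∃ t : ℕ, (ρ g).val.trace = t := by
  let e := Fintype.equivFin κ
  let Q : G →* Matrix (Fin (Fintype.card κ)) (Fin (Fintype.card κ)) ℂ :=
    ((Matrix.reindexAlgEquiv ℂ ℂ e : Matrix κ κ ℂ →* _)).comp P
  refine ⟨Q.toHomUnits, fun x y h => ?_, fun g => ?_⟩
  · exact hP ((Matrix.reindexAlgEquiv ℂ ℂ e).injective (congrArg Units.val h))
  · obtain ⟨t, ht⟩ := htr g
    refine ⟨t, ?_⟩
    rw [← ht]
    exact Equiv.sum_comp e.symm fun i => P g i i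

theorem exists_galois_sum {p : ℕ} [Fact p.Prime] (hexp : ∀ g : G, g ^ p = 1) {m : ℕ}
    (M : G →* Matrix (Fin m) (Fin m) ℂ) :
    ∃ N : G →* Matrix (Fin m × ZMod p) (Fin m × ZMod p) ℂ,
      (∀ g, N g = 1 → M g = 1) ∧ ∀ g, ∃ t : ℕ, (N g).trace = t := by
  choose σ hσ using fun k : {k : ZMod p // k ≠ 0} => exists_ringEquiv_stdAddChar k.2
  let C : ZMod p → G →* Matrix (Fin m) (Fin m) ℂ := fun k =>
    if hk : k = 0 then 1 else
      (RingHom.mapMatrix (σ ⟨k, hk⟩ : ℂ →+* ℂ)).toMonoidHom.comp M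
  refine ⟨(Matrix.blockDiagonalRingHom (Fin m) (ZMod p) ℂ).toMonoidHom.comp (MonoidHom.pi C),
    fun g hg => ?_, fun g => ?_⟩
  · have h1 : Matrix.blockDiagonal (fun k => C k g) =
        Matrix.blockDiagonal (1 : ZMod p → Matrix (Fin m) (Fin m) ℂ) :=
      hg.trans Matrix.blockDiagonal_one.symm
    have h2 : C 1 g = 1 := congrFun (Matrix.blockDiagonal_injective h1) 1
    simp only [C, one_ne_zero, dite_false] at h2
    have h3 : (σ ⟨1, one_ne_zero⟩ : ℂ →+* ℂ).mapMatrix (M g) =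
      (σ ⟨1, one_ne_zero⟩ : ℂ →+* ℂ).mapMatrix 1 := h2.trans (map_one _).symm
    exact Matrix.map_injective (σ ⟨1, one_ne_zero⟩).injective h3
  · have hf : (Matrix.toLin' (M g)) ^ p = 1 := by
      rw [← Matrix.toLin'_pow, ← map_pow, hexp, map_one, Matrix.toLin'_one]; rfl
    obtain ⟨c, h1, h2⟩ := exists_eigenvalue_multiplicities hf
    rw [Matrix.trace_toLin'_eq] at h1
    rw [Module.finrank_fin_fun] at h2
    refine ⟨p * c 0, ?_⟩
    have h3 : ∀ k, (C k g).trace = ∑ j, ZMod.stdAddChar (k * j) * (c j : ℂ) := by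
      intro k
      by_cases hk : k = 0
      · simp [C, hk, h2]
      · have : (C k g).trace = σ ⟨k, hk⟩ ((M g).trace) := by
          simp only [C, hk, dite_false]
          exact (AddMonoidHom.map_trace (σ ⟨k, hk⟩ : ℂ →+* ℂ).toAddMonoidHom (M g)).symm
        rw [this, h1]
        simp [hσ]
    change (Matrix.blockDiagonal fun k => C k g).trace = _
    rw [Matrix.trace_blockDiagonal]
    simp_rw [h3]
    rw [Finset.sum_comm]
    simp_rw [← Finset.sum_mul, sum_stdAddChar_mul]
    simp

theorem exists_generalLinearGroup_of_family {p : ℕ} [Fact p.Prime] (hexp : ∀ g : G, g ^ p = 1) {d m : ℕ}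
    (M : Fin d → G →* Matrix (Fin m) (Fin m) ℂ) (hM : ∀ g, (∀ i, M i g = 1) → g = 1) :
    ∃ ρ : G →* Matrix.GeneralLinearGroup (Fin (p * (d * m))) ℂ, Function.Injective ρ ∧
      ∀ g : G, ∃ t : ℕ, (ρ g).val.trace = t := by
  choose N hN htr using fun i => exists_galois_sum hexp (M i)
  let P := (Matrix.blockDiagonalRingHom (Fin m × ZMod p) (Fin d) ℂ).toMonoidHom.comp (MonoidHom.pi N)
  have hcard : Fintype.card ((Fin m × ZMod p) × Fin d) = p * (d * m) := by
    simp only [Fintype.card_prod, Fintype.card_fin, ZMod.card]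
    ring
  rw [← hcard]
  refine exists_generalLinearGroup_of_matrix P ?_ fun g => ?_
  · rw [injective_iff_map_eq_one]
    intro g hg
    refine hM g fun i => hN i g ?_
    have h1 : Matrix.blockDiagonal (fun k => N k g) =
        Matrix.blockDiagonal (1 : Fin d → Matrix (Fin m × ZMod p) (Fin m × ZMod p) ℂ) :=
      hg.trans Matrix.blockDiagonal_one.symm
    exact congrFun (Matrix.blockDiagonal_injective h1) i
  · choose t ht using fun i => htr i g
    refine ⟨∑ i, t i, ?_⟩
    change (Matrix.blockDiagonal fun k => N k g).trace = _
    rw [Matrix.trace_blockDiagonal]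
    simp [ht]

end Upper

theorem injective_leftRegular {G : Type*} [Group G] :
    Function.Injective (Representation.leftRegular ℂ G) := by
  intro x y h
  have h1 := LinearMap.congr_fun h (MonoidAlgebra.single 1 1)
  simp only [Representation.ofMulAction_single, smul_eq_mul, mul_one] at h1
  exact MonoidAlgebra.of_injective (R := ℂ) h1

section Main

open scoped IsMulCommutative

variable {p : ℕ} [Fact p.Prime] {G : Type} [Group G] [Finite G]

theorem exists_faithful_of_cdSet [Module (ZMod p) (Additive ↥(Subgroup.center G))]
    (hexp : ∀ g : G, g ^ p = 1)
    (hZ : Subgroup.center G ≤ commutator G) {m : ℕ} (hm : m ≠ 0) (hcd : cdSet G = {1, m}) :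
    ∃ ρ : G →* Matrix.GeneralLinearGroup (Fin (p * (minGens ↥(Subgroup.center G) * m))) ℂ,
      Function.Injective ρ ∧
      ∀ g : G, ∃ t : ℕ, (ρ g).val.trace = t := by
  have hpG : IsPGroup p G := fun g => ⟨1, by simpa using hexp g⟩
  have : Module.Finite ℂ (MonoidAlgebra ℂ G) :=
    Module.Finite.equiv (MonoidAlgebra.coeffLinearEquiv ℂ).symm
  obtain ⟨b, hb⟩ := exists_basis_invariant (p := p) hZ hcd (Representation.leftRegular ℂ G)
    injective_leftRegular
  choose W hWb hW hWm using hb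
  let σ : ∀ i, Representation ℂ G (W i) := fun i =>
    Subrepresentation.toRepresentation ⟨W i, fun g v hv => hW i g hv⟩
  let e i := LinearMap.toMatrixAlgEquiv (Module.finBasisOfFinrankEq ℂ (W i) (hWm i))
  refine exists_generalLinearGroup_of_family hexp
    (fun i => (e i : Module.End ℂ (W i) →* Matrix (Fin m) (Fin m) ℂ).comp (σ i)) fun g hg => ?_
  have hσ : ∀ i, σ i g = 1 := fun i => (e i).injective ((hg i).trans (map_one _).symm)
  have hK : (⨅ i, MonoidHom.ker (σ i)) ⊓ Subgroup.center G = ⊥ := by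
    rw [eq_bot_iff]
    rintro x ⟨hx, hxc⟩
    let y : Additive ↥(Subgroup.center G) := Additive.ofMul ⟨x, hxc⟩
    have hy : ∀ i, b i y = 0 := by
      intro i
      have : Nontrivial (W i) := Module.nontrivial_of_finrank_pos (R := ℂ) (by rw [hWm]; omega)
      obtain ⟨v, hv⟩ := exists_ne (0 : W i)
      have h1 : σ i x = 1 := Subgroup.mem_iInf.1 hx i
      have h2 := congrArg Subtype.val (LinearMap.congr_fun h1 v)
      have h3 := apply_of_mem_range_weightProj (centerRep (Representation.leftRegular ℂ G)) (b i)
        (hWb i v.2) y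
      have h4 : (ZMod.stdAddChar (b i y) : ℂ) • (v : MonoidAlgebra ℂ G) =
          (1 : ℂ) • (v : MonoidAlgebra ℂ G) := by
        rw [one_smul]
        exact h3.symm.trans h2
      have h5 := smul_left_injective ℂ (fun h => hv (Subtype.ext h)) h4
      rw [← AddChar.map_zero_eq_one (ZMod.stdAddChar (N := p))] at h5
      exact ZMod.injective_stdAddChar h5
    have hy0 : y = 0 := by
      rw [← Module.forall_dual_apply_eq_zero_iff (ZMod p)]
      intro f
      have h6 : Module.Dual.eval (ZMod p) _ y = 0 := b.ext fun i => hy i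
      exact LinearMap.congr_fun h6 f
    exact Subgroup.mem_bot.2 (congrArg (fun z => ((Additive.toMul z : ↥(Subgroup.center G)) : G)) hy0)
  have : (⨅ i, MonoidHom.ker (σ i)).Normal := Subgroup.normal_iInf_normal fun i => inferInstance
  have h7 := hpG.eq_bot_of_normal_of_inf_center_eq_bot hK
  have h8 : g ∈ ⨅ i, MonoidHom.ker (σ i) := Subgroup.mem_iInf.2 hσ
  rw [h7] at h8
  exact Subgroup.mem_bot.1 h8

theorem quasiPermDegree_eq_of_module [Module (ZMod p) (Additive ↥(Subgroup.center G))]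
    (hexp : ∀ g : G, g ^ p = 1)
    (hZ : Subgroup.center G ≤ commutator G) {m : ℕ} (hm : m ≠ 0) (hcd : cdSet G = {1, m}) :
    quasiPermDegree G = p * (minGens ↥(Subgroup.center G) * m) := by
  have hmem := exists_faithful_of_cdSet hexp hZ hm hcd
  refine le_antisymm (Nat.sInf_le hmem) (le_csInf ⟨_, hmem⟩ ?_)
  rintro n ⟨ρ, hρ, htr⟩
  let R : Representation ℂ G (Fin n → ℂ) :=
    (Matrix.toLinAlgEquiv' : Matrix (Fin n) (Fin n) ℂ ≃ₐ[ℂ] _).toRingEquiv.toMonoidHom.comp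
      ((Units.coeHom _).comp ρ)
  have hR : Function.Injective R := fun x y h =>
    hρ (Units.ext (Matrix.toLinAlgEquiv'.injective h))
  have h := le_finrank_of_trace (p := p) hZ hcd R hR fun g => ?_
  · rwa [Module.finrank_fin_fun] at h
  · obtain ⟨t, ht⟩ := htr g
    exact ⟨t, (Matrix.trace_toLin'_eq _).trans ht⟩

theorem quasiPermDegree_eq_of_cdSet (hexp : ∀ g : G, g ^ p = 1)
    (hZ : Subgroup.center G ≤ commutator G) {m : ℕ} (hm : m ≠ 0) (hcd : cdSet G = {1, m}) :
    quasiPermDegree G = p * (minGens ↥(Subgroup.center G) * m) := by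
  let : Module (ZMod p) (Additive ↥(Subgroup.center G)) :=
    AddCommGroup.zmodModule fun x => Subtype.ext (hexp (Additive.toMul x : ↥(Subgroup.center G)))
  exact quasiPermDegree_eq_of_module hexp hZ hm hcd

end Main

theorem stmt10 (G : Type) [Group G] [Finite G] (p n s : ℕ) (hp : p.Prime)
    (hcard : Nat.card G = p ^ n) (hna : ¬ ∀ x y : G, x * y = y * x)
    (hexp : Monoid.exponent G = p) (hs : 1 < s) (hcd : cdSet G = {1, p ^ s})
    (hd : minGens ↥(Subgroup.center G ⊓ commutator G) = minGens ↥(Subgroup.center G)) :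
    quasiPermDegree G = minGens ↥(Subgroup.center G) * p ^ (s + 1) := by
  have : Fact p.Prime := ⟨hp⟩
  have hexp' : ∀ g : G, g ^ p = 1 := fun g => hexp ▸ Monoid.pow_exponent_eq_one g
  rw [quasiPermDegree_eq_of_cdSet hexp' (center_le_commutator_of_minGens hexp' hd)
    (pow_ne_zero s hp.ne_zero) hcd]
  ring
end

section
/- Let G be a finite non-abelian p-group with exp(G) = p^b and max cd(G) = p^e, and suppose c(G) = a_1 p + a_2 p^2 + ... + a_r p^r with 0 ≤ a_i < p and a_r ≠ 0. Then b ≤ r; furthermore, if d(Z(G)) < p then r ≤ b + e. -/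
open FDRep CategoryTheory Subgroup

theorem RingHom.exists_extension_of_isAlgebraic {A S M : Type*} [CommRing A] [IsDomain A]
    [Field S] [Field M] [IsAlgClosed M] [Algebra A S] [Algebra.IsAlgebraic A S]
    (hi : Function.Injective (algebraMap A S))
    (j : A →+* M) (hj : Function.Injective j) :
    ∃ f : S →+* M, ∀ a, f (algebraMap A S a) = j a := by
  let _ := j.toAlgebra
  have : Module.IsTorsionFree A S := Module.isTorsionFree_iff_algebraMap_injective.2 hi
  have : Module.IsTorsionFree A M := Module.isTorsionFree_iff_algebraMap_injective.2 hj
  exact ⟨(IsAlgClosed.lift : S →ₐ[A] M).toRingHom, fun a => AlgHom.commutes _ a⟩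

theorem RingHom.exists_extension_of_endomorphism {K S : Type} [Field K] [Field S] [IsAlgClosed S]
    [Algebra K S] (τ : K →+* K) :
    ∃ f : S →+* S, ∀ a, f (algebraMap K S a) = algebraMap K S (τ a) := by
  obtain ⟨s, hs⟩ := exists_isTranscendenceBasis K S
  have hind := hs.1
  have := hs.isAlgebraic
  let e := hind.aevalEquiv
  let j : Algebra.adjoin K (Set.range ((↑) : s → S)) →+* S :=
    (MvPolynomial.aeval ((↑) : s → S)).toRingHom.comp
      ((MvPolynomial.map τ).comp e.symm.toRingEquiv.toRingHom)
  have hj : Function.Injective j :=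
    Function.Injective.comp (g := MvPolynomial.aeval ((↑) : s → S)) hind
      ((MvPolynomial.map_injective τ τ.injective).comp e.symm.injective)
  obtain ⟨f, hf⟩ := RingHom.exists_extension_of_isAlgebraic
    (S := S) (FaithfulSMul.algebraMap_injective _ _) j hj
  refine ⟨f, fun a => ?_⟩
  have h1 := hf (algebraMap K _ a)
  have h2 : e.symm (algebraMap K _ a) = MvPolynomial.C a := by
    rw [e.symm.commutes]; rfl
  rw [← IsScalarTower.algebraMap_apply] at h1
  rw [h1]
  change MvPolynomial.aeval _ (MvPolynomial.map τ (e.symm (algebraMap K _ a))) = _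
  rw [h2, MvPolynomial.map_C]
  simp

theorem IsCyclotomicExtension.Rat.exists_ringHom_zeta_eq_pow {n t : ℕ} [NeZero n]
    (K : Type) [Field K] [Algebra ℚ K] [IsCyclotomicExtension {n} ℚ K] (ht : t.Coprime n) :
    ∃ (ζ : K) (τ : K →+* K), IsPrimitiveRoot ζ n ∧ τ ζ = ζ ^ t := by
  have hirr := Polynomial.cyclotomic.irreducible_rat (NeZero.pos n)
  let ζ := IsCyclotomicExtension.zeta n ℚ K
  have hζ : IsPrimitiveRoot ζ n := IsCyclotomicExtension.zeta_spec n ℚ K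
  refine ⟨ζ, ?_⟩
  let u := ZMod.unitOfCoprime t ht
  let τ := (IsCyclotomicExtension.autEquivPow K hirr).symm u
  refine ⟨τ.toAlgHom.toRingHom, hζ, ?_⟩
  have h := IsCyclotomicExtension.autEquivPow_apply K hirr τ
  have hτ : IsCyclotomicExtension.autEquivPow K hirr τ = u := MulEquiv.apply_symm_apply _ _
  rw [hτ] at h
  have := hζ.autToPow_spec ℚ τ
  rw [show hζ.autToPow ℚ τ = u from h.symm] at this
  change τ ζ = _
  rw [← this]
  simp only [u, ZMod.coe_unitOfCoprime, ZMod.val_natCast]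
  rw [hζ.eq_orderOf, pow_mod_orderOf]

theorem Complex.exists_ringHom_pow_of_coprime {n t : ℕ} [NeZero n] (ht : t.Coprime n) :
    ∃ σ : ℂ →+* ℂ, ∀ z : ℂ, z ^ n = 1 → σ z = z ^ t := by
  have : NeZero (n : ℚ) := ⟨Nat.cast_ne_zero.2 (NeZero.ne n)⟩
  obtain ⟨ζ, τ, hζ, hτ⟩ :=
    @IsCyclotomicExtension.Rat.exists_ringHom_zeta_eq_pow n t _ (CyclotomicField n ℚ) _
      (CyclotomicField.algebra n ℚ) (CyclotomicField.isCyclotomicExtension n ℚ) ht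
  let _ : Algebra (CyclotomicField n ℚ) ℂ :=
    (IsAlgClosed.lift : CyclotomicField n ℚ →ₐ[ℚ] ℂ).toRingHom.toAlgebra
  obtain ⟨σ, hσ⟩ := RingHom.exists_extension_of_endomorphism (S := ℂ) τ
  refine ⟨σ, fun z hz => ?_⟩
  have hζ' := hζ.map_of_injective (algebraMap (CyclotomicField n ℚ) ℂ).injective
  obtain ⟨i, -, rfl⟩ := hζ'.eq_pow_of_pow_eq_one hz
  rw [map_pow, hσ, hτ, map_pow, ← pow_mul, ← pow_mul, mul_comm]

theorem Matrix.exists_eigenvalues_of_pow_eq_one {m : Type} [Fintype m] [DecidableEq m]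
    {A : Matrix m m ℂ} {M : ℕ} (hM : 0 < M) (hA : A ^ M = 1) :
    ∃ (ι : Type) (_ : Fintype ι) (d : ι → ℂ), Fintype.card ι = Fintype.card m ∧
      (∀ k, (A ^ k).trace = ∑ i, d i ^ k) ∧
      ∀ q, A ^ q = 1 ↔ ∀ i, d i ^ q = 1 := by
  let f : Module.End ℂ (m → ℂ) := Matrix.toLin' A
  have hf : f ^ M = 1 := by
    rw [← Matrix.toLin'_pow, hA, Matrix.toLin'_one]; rfl
  have hss : f.IsSemisimple := by
    refine Module.End.isSemisimple_of_squarefree_aeval_eq_zero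
      (p := Polynomial.X ^ M - 1) ?_ (by simp [hf])
    exact (Polynomial.separable_X_pow_sub_C (1 : ℂ)
      (by exact_mod_cast hM.ne') one_ne_zero).squarefree
  have htop : ⨆ μ, f.eigenspace μ = ⊤ := by
    rw [← Module.End.iSup_maxGenEigenspace_eq_top f]
    exact iSup_congr fun μ => (hss.isFinitelySemisimple.maxGenEigenspace_eq_eigenspace μ).symm
  have hspan : ⊤ ≤ Submodule.span ℂ (⋃ μ, (f.eigenspace μ : Set (m → ℂ))) := by
    rw [Submodule.span_iUnion]; simp [htop]
  let b := Module.Basis.ofSpan hspan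
  have := FiniteDimensional.fintypeBasisIndex b
  have hb : ∀ i, ∃ μ : ℂ, f (b i) = μ • b i := by
    intro i
    have : b i ∈ ⋃ μ, (f.eigenspace μ : Set (m → ℂ)) :=
      Module.Basis.ofSpan_subset hspan ⟨i, rfl⟩
    obtain ⟨μ, hμ⟩ := Set.mem_iUnion.1 this
    exact ⟨μ, Module.End.mem_eigenspace_iff.1 hμ⟩
  choose d hd using hb
  have hpow : ∀ k i, (f ^ k) (b i) = d i ^ k • b i := by
    intro k i
    induction k with
    | zero => simp
    | succ k ih => rw [pow_succ', Module.End.mul_apply, ih, map_smul, hd, smul_smul, pow_succ]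
  refine ⟨_, inferInstance, d, ?_, fun k => ?_, fun q => ?_⟩
  · rw [← Module.finrank_eq_card_basis b, Module.finrank_fintype_fun_eq_card]
  · rw [← Matrix.trace_toLin'_eq, Matrix.toLin'_pow, LinearMap.trace_eq_matrix_trace ℂ b,
      Matrix.trace]
    refine Finset.sum_congr rfl fun i _ => ?_
    rw [Matrix.diag_apply, LinearMap.toMatrix_apply, hpow]
    simp
  · rw [← Matrix.toLin'.injective.eq_iff, Matrix.toLin'_pow, Matrix.toLin'_one]
    constructor
    · intro h i
      have h1 := hpow q i
      rw [show f ^ q = LinearMap.id from h, LinearMap.id_apply] at h1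
      have h2 : (d i ^ q - 1) • b i = 0 := by rw [sub_smul, ← h1, one_smul, sub_self]
      exact sub_eq_zero.1 ((smul_eq_zero.1 h2).resolve_right (b.ne_zero i))
    · intro h
      refine b.ext fun i => ?_
      change (f ^ q) (b i) = _
      rw [hpow, h, one_smul, LinearMap.id_apply]

theorem geom_sum_of_pow_eq_one {K : Type*} [Field K] {M : ℕ} {z : K} (hz : z ^ M = 1)
    [Decidable (z = 1)] :
    ∑ k ∈ Finset.range M, z ^ k = if z = 1 then (M : K) else 0 := by
  split_ifs with h
  · simp [h]
  · rw [geom_sum_eq h, hz, sub_self, zero_div]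

open scoped Classical in
theorem card_filter_eq_pow_of_powerSums {ι : Type} [Fintype ι] {M t : ℕ} [NeZero M] {d : ι → ℂ}
    (hd : ∀ i, d i ^ M = 1) {f : ℕ → ℕ} (hf : ∀ k, ∑ i, d i ^ k = f k) (ht : t.Coprime M)
    {z : ℂ} (hz : z ^ M = 1) :
    (Finset.univ.filter fun i => d i = z ^ t).card = (Finset.univ.filter fun i => d i = z).card := by
  have key : ∀ w : ℂ, w ^ M = 1 → ∑ k ∈ Finset.range M, w⁻¹ ^ k * (f k : ℂ) =
      M * (Finset.univ.filter fun i => d i = w).card := by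
    intro w hw
    have hw0 : w ≠ 0 := by
      rintro rfl
      simp [NeZero.ne M] at hw
    simp_rw [← hf, Finset.mul_sum, ← mul_pow]
    rw [Finset.sum_comm]
    have : ∀ i, ∑ k ∈ Finset.range M, (w⁻¹ * d i) ^ k = if d i = w then (M : ℂ) else 0 := by
      intro i
      rw [geom_sum_of_pow_eq_one (by rw [mul_pow, inv_pow, hw, hd, inv_one, one_mul])]
      simp only [inv_mul_eq_one₀ hw0, eq_comm]
    simp_rw [this]
    rw [← Finset.sum_filter, Finset.sum_const, nsmul_eq_mul, mul_comm]
  obtain ⟨σ, hσ⟩ := Complex.exists_ringHom_pow_of_coprime ht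
  have h1 := key _ (show (z ^ t) ^ M = 1 by rw [← pow_mul, mul_comm, pow_mul, hz, one_pow])
  have h2 := congrArg σ (key z hz)
  simp only [map_sum, map_mul, map_pow, map_inv₀, map_natCast, hσ z hz] at h2
  rw [h1] at h2
  exact_mod_cast mul_left_cancel₀ (Nat.cast_ne_zero.2 (NeZero.ne M)) h2

open scoped Classical in
theorem Matrix.prime_pow_le_card_of_trace_natCast {m : Type} [Fintype m] [DecidableEq m]
    {p b : ℕ} (hp : p.Prime) {A : Matrix m m ℂ}
    (h1 : A ^ p ^ (b + 1) = 1) (h2 : A ^ p ^ b ≠ 1) (htr : ∀ k, ∃ n : ℕ, (A ^ k).trace = n) :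
    p ^ (b + 1) ≤ Fintype.card m := by
  have : Fact p.Prime := ⟨hp⟩
  obtain ⟨ι, _, d, hcard, htrace, hpow⟩ := Matrix.exists_eigenvalues_of_pow_eq_one
    (pow_pos hp.pos _) h1
  have hd := (hpow _).1 h1
  choose f hf using htr
  simp_rw [htrace] at hf
  rw [Ne, hpow] at h2
  push Not at h2
  obtain ⟨i, hi⟩ := h2
  have hprim : IsPrimitiveRoot (d i) (p ^ (b + 1)) := by
    rw [IsPrimitiveRoot.iff_orderOf]
    exact orderOf_eq_prime_pow hi (hd i)
  set E := Finset.univ.filter fun i => ¬ d i ^ p ^ b = 1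
  set D := Finset.univ.filter fun i => d i ^ p ^ b = 1
  have hE : p ^ b * (p - 1) ≤ E.card := by
    rw [← Nat.totient_prime_pow_succ hp, ← hprim.card_primitiveRoots]
    refine (Finset.card_le_card fun z hz => ?_).trans (Finset.card_image_le (f := d))
    rw [mem_primitiveRoots (pow_pos hp.pos _)] at hz
    obtain ⟨t, -, ht, rfl⟩ := hprim.isPrimitiveRoot_iff.1 hz
    have hc := card_filter_eq_pow_of_powerSums hd hf ht (hd i)
    have hne : (Finset.univ.filter fun j => d j = d i ^ t).Nonempty := by
      rw [← Finset.card_pos, hc, Finset.card_pos]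
      exact ⟨i, by simp⟩
    obtain ⟨j, hj⟩ := hne
    have hj := (Finset.mem_filter.1 hj).2
    refine Finset.mem_image.2 ⟨j, Finset.mem_filter.2 ⟨Finset.mem_univ _, fun h => ?_⟩, hj⟩
    rw [hj] at h
    exact absurd ((IsPrimitiveRoot.pow_eq_one_iff_dvd hz _).1 h)
      (Nat.not_dvd_of_pos_of_lt (pow_pos hp.pos _)
        (Nat.pow_lt_pow_right hp.one_lt (Nat.lt_succ_self b)))
  have hDE : D.card + E.card = Fintype.card m := by
    rw [← hcard]; exact Finset.card_filter_add_card_filter_not _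
  have hD : Fintype.card m ≤ p * D.card := by
    have h0 : f 0 = Fintype.card m := by
      have := hf 0
      simp only [pow_zero, Finset.sum_const, Finset.card_univ, nsmul_one, hcard] at this
      exact_mod_cast this.symm
    have hs : ∑ s ∈ Finset.range p, f (p ^ b * s) = p * D.card := by
      have : ((∑ s ∈ Finset.range p, f (p ^ b * s) : ℕ) : ℂ) = (p * D.card : ℕ) := by
        push_cast
        simp_rw [← hf, pow_mul]
        rw [Finset.sum_comm]
        have : ∀ i, ∑ k ∈ Finset.range p, (d i ^ p ^ b) ^ k
            = if d i ^ p ^ b = 1 then (p : ℂ) else 0 := fun i =>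
          geom_sum_of_pow_eq_one (by rw [← pow_mul, ← pow_succ, hd])
        simp_rw [this]
        rw [← Finset.sum_filter, Finset.sum_const, nsmul_eq_mul, mul_comm]
      exact_mod_cast this
    rw [← hs, ← h0]
    exact Finset.single_le_sum (f := fun s => f (p ^ b * s)) (fun _ _ => Nat.zero_le _)
      (Finset.mem_range.2 hp.pos)
  obtain ⟨q, rfl⟩ : ∃ q, p = q + 1 := ⟨p - 1, (Nat.succ_pred_eq_of_pos hp.pos).symm⟩
  have hq : 0 < q := by have := hp.one_lt; omega
  rw [Nat.add_sub_cancel] at hE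
  refine le_of_mul_le_mul_left (a := q) ?_ hq
  rw [pow_succ]
  nlinarith

theorem exists_natCast_eq_sum_ite_dvd {K : Type*} [Field K] {p b : ℕ} (hp : 0 < p) {z : K}
    (hz : z ^ p ^ (b + 1) = 1) :
    ∃ n : ℕ, ∑ t ∈ Finset.range (p ^ (b + 1)), (if p ∣ t then 1 else z ^ t) = (n : K) := by
  classical
  by_cases h1 : z = 1
  · exact ⟨p ^ (b + 1), by simp [h1]⟩
  have hsplit : ∀ t, (if p ∣ t then 1 else z ^ t) = z ^ t + if p ∣ t then 1 - z ^ t else 0 := by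
    intro t
    split_ifs <;> ring
  have himg : (Finset.range (p ^ (b + 1))).filter (p ∣ ·) =
      (Finset.range (p ^ b)).image (p * ·) := by
    ext t
    simp only [Finset.mem_filter, Finset.mem_range, Finset.mem_image, pow_succ']
    constructor
    · rintro ⟨ht, s, rfl⟩
      exact ⟨s, Nat.lt_of_mul_lt_mul_left ht, rfl⟩
    · rintro ⟨s, hs, rfl⟩
      exact ⟨Nat.mul_lt_mul_of_pos_left hs hp, dvd_mul_right _ _⟩
  simp_rw [hsplit]
  rw [Finset.sum_add_distrib, geom_sum_of_pow_eq_one hz, if_neg h1, zero_add, ← Finset.sum_filter,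
    himg, Finset.sum_image fun _ _ _ _ h => Nat.eq_of_mul_eq_mul_left hp h, Finset.sum_sub_distrib]
  simp_rw [pow_mul]
  rw [geom_sum_of_pow_eq_one (by rw [← pow_mul, ← pow_succ', hz])]
  split_ifs
  · exact ⟨0, by simp⟩
  · exact ⟨p ^ b, by simp⟩

theorem exists_injective_generalLinearGroup_trace_natCast {G : Type*} [Group G] {p b : ℕ}
    (hp : p.Prime) (hexp : ∀ g : G, g ^ p ^ (b + 1) = 1) {ι : Type} [Fintype ι] (k : ι → ℕ)
    (R : ∀ i, G →* Matrix (Fin (k i)) (Fin (k i)) ℂ) (hR : ∀ g, (∀ i, R i g = 1) → g = 1) :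
    ∃ ρ : G →* Matrix.GeneralLinearGroup (Fin ((∑ i, k i) * p ^ (b + 1))) ℂ,
      Function.Injective ρ ∧ ∀ g : G, ∃ m : ℕ, Matrix.trace (ρ g).val = (m : ℂ) := by
  classical
  have : NeZero (p ^ (b + 1)) := ⟨(pow_pos hp.pos _).ne'⟩
  have hσ : ∀ t : ℕ, ∃ σ : ℂ →+* ℂ, ¬ p ∣ t → ∀ z : ℂ, z ^ p ^ (b + 1) = 1 → σ z = z ^ t := by
    intro t
    by_cases h : p ∣ t
    · exact ⟨RingHom.id ℂ, fun h' => absurd h h'⟩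
    · obtain ⟨σ, hσ⟩ := Complex.exists_ringHom_pow_of_coprime
        (((Nat.Prime.coprime_iff_not_dvd hp).2 h).symm.pow_right (b + 1))
      exact ⟨σ, fun _ => hσ⟩
  choose σ hσ using hσ
  let B : ∀ x : ι × Fin (p ^ (b + 1)), G →* Matrix (Fin (k x.1)) (Fin (k x.1)) ℂ := fun x =>
    if p ∣ x.2 then 1 else (σ x.2).mapMatrix.toMonoidHom.comp (R x.1)
  let e : (Σ x : ι × Fin (p ^ (b + 1)), Fin (k x.1)) ≃ Fin ((∑ i, k i) * p ^ (b + 1)) :=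
    Fintype.equivFinOfCardEq (by
      simp [Fintype.card_sigma, Fintype.sum_prod_type, Finset.sum_mul, mul_comm])
  let F : G →* Matrix (Fin ((∑ i, k i) * p ^ (b + 1))) (Fin ((∑ i, k i) * p ^ (b + 1))) ℂ :=
    ((Matrix.reindexAlgEquiv ℂ ℂ e).toAlgHom.toRingHom.toMonoidHom.comp
      (Matrix.blockDiagonal'RingHom (fun x : ι × Fin (p ^ (b + 1)) => Fin (k x.1)) ℂ).toMonoidHom).comp
        (MonoidHom.pi B)
  have hF : ∀ g, F g = Matrix.reindexAlgEquiv ℂ ℂ e (Matrix.blockDiagonal' fun x => B x g) :=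
    fun _ => rfl
  refine ⟨F.toHomUnits, ?_, fun g => ?_⟩
  · rw [injective_iff_map_eq_one]
    intro g hg
    have h1 : F g = 1 := congrArg Units.val hg
    rw [hF, ← map_one (Matrix.reindexAlgEquiv ℂ ℂ e), EmbeddingLike.apply_eq_iff_eq,
      ← Matrix.blockDiagonal'_one] at h1
    have h2 := Matrix.blockDiagonal'_injective h1
    refine hR g fun i => ?_
    have h3 := congrFun h2 (i, ⟨1, Nat.one_lt_pow (Nat.succ_ne_zero b) hp.one_lt⟩)
    simp only [B, Nat.dvd_one, hp.ne_one, if_false] at h3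
    refine Matrix.map_injective (σ 1).injective ?_
    have h4 : (R i g).map (σ 1) = 1 := h3
    exact h4.trans (Matrix.map_one _ (map_zero _) (map_one _)).symm
  · have key : ∀ i, ∃ n : ℕ, ∑ t ∈ Finset.range (p ^ (b + 1)),
        (if p ∣ t then (k i : ℂ) else σ t (R i g).trace) = n := by
      intro i
      have hA : R i g ^ p ^ (b + 1) = 1 := by rw [← map_pow, hexp, map_one]
      obtain ⟨J, _, d, hcard, htrace, hpow⟩ := Matrix.exists_eigenvalues_of_pow_eq_one
        (pow_pos hp.pos _) hA
      have hd := (hpow _).1 hA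
      choose n hn using fun j => exists_natCast_eq_sum_ite_dvd hp.pos (hd j)
      refine ⟨∑ j, n j, ?_⟩
      push_cast
      simp_rw [← hn]
      rw [Finset.sum_comm]
      refine Finset.sum_congr rfl fun t _ => ?_
      split_ifs with h
      · simp [hcard]
      · have := htrace 1
        simp only [pow_one] at this
        rw [this, map_sum]
        exact Finset.sum_congr rfl fun j _ => hσ t h _ (hd j)
    choose n hn using key
    refine ⟨∑ i, n i, ?_⟩
    have : (F g).trace = (Matrix.blockDiagonal' fun x => B x g).trace :=
      e.symm.sum_comp fun x => (Matrix.blockDiagonal' fun x => B x g) x x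
    change (F g).trace = _
    rw [this, Matrix.trace_blockDiagonal', Fintype.sum_prod_type]
    push_cast
    refine Finset.sum_congr rfl fun i _ => ?_
    rw [← hn, ← Fin.sum_univ_eq_sum_range
      (fun t => if p ∣ t then (k i : ℂ) else σ t (R i g).trace)]
    refine Finset.sum_congr rfl fun t _ => ?_
    simp only [B]
    split_ifs with h
    · simp
    · exact (AddMonoidHom.map_trace (σ t).toAddMonoidHom (R i g)).symm

theorem exists_finset_characters_separating (A : Type) [CommGroup A] [Finite A] :
    ∃ S : Finset (A →* ℂˣ), S.card = minGens A ∧ ∀ z : A, (∀ χ ∈ S, χ z = 1) → z = 1 := by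
  classical
  have := Fintype.ofFinite A
  have hne : {n | ∃ S : Finset A, S.card = n ∧ Subgroup.closure (S : Set A) = ⊤}.Nonempty :=
    ⟨_, Finset.univ, rfl, by simp⟩
  obtain ⟨S, hS, hgen⟩ := Nat.sInf_mem hne
  obtain ⟨f⟩ := CommGroup.monoidHom_mulEquiv_of_hasEnoughRootsOfUnity A ℂ
  refine ⟨S.map f.symm.toEquiv.toEmbedding, by rw [Finset.card_map, hS]; rfl, fun z hz => ?_⟩
  by_contra hz1
  obtain ⟨χ, hχ⟩ := CommGroup.exists_apply_ne_one_of_hasEnoughRootsOfUnity A ℂ hz1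
  refine hχ ?_
  let ev : A →* ℂˣ := ((MonoidHom.eval z).comp f.symm.toMonoidHom)
  have : (⊤ : Subgroup A) ≤ ev.ker := by
    rw [← hgen, Subgroup.closure_le]
    intro s hs
    exact hz _ (Finset.mem_map_of_mem _ hs)
  have h := this (Subgroup.mem_top (f χ))
  rw [MonoidHom.mem_ker] at h
  simpa [ev] using h

theorem IsPGroup.exists_mem_center_of_normal {G : Type*} [Group G] [Finite G] {p : ℕ}
    [Fact p.Prime] (hG : IsPGroup p G) (N : Subgroup G) [N.Normal] (hN : N ≠ ⊥) :
    ∃ z ∈ N, z ∈ Subgroup.center G ∧ z ≠ 1 := by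
  have : Nontrivial N := (Subgroup.nontrivial_iff_ne_bot N).2 hN
  have hdvd : p ∣ Nat.card N := by
    obtain ⟨n, hn0, hn⟩ := (hG.to_subgroup N).nontrivial_iff_card.mp inferInstance
    exact hn.symm ▸ dvd_pow_self _ (ne_of_gt hn0)
  obtain ⟨z, hz, hne⟩ :=
    (hG.of_equiv ConjAct.toConjAct).exists_fixed_point_of_prime_dvd_card_of_fixed_point N hdvd
      (a := 1) fun g => by ext; simp
  refine ⟨z, z.2, Subgroup.mem_center_iff.2 fun g => ?_, fun h => hne (Subtype.ext h.symm)⟩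
  have := congrArg Subtype.val (hz (ConjAct.toConjAct g))
  rw [ConjAct.Subgroup.val_conj_smul, ConjAct.toConjAct_smul] at this
  exact mul_inv_eq_iff_eq_mul.1 this

/-- The functions on `G` that transform under left translation by the center through `χ`. -/
def centralFunctions (G : Type) [Group G] (χ : Subgroup.center G →* ℂˣ) : Submodule ℂ (G → ℂ) where
  carrier := {f | ∀ (z : Subgroup.center G) (x : G), f (z * x) = χ z * f x}
  add_mem' hf hg z x := by simp [hf z x, hg z x, mul_add]
  zero_mem' z x := by simp
  smul_mem' c f hf z x := by simp [hf z x, mul_left_comm]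

/-- The action of `G` on `centralFunctions G χ` by right translation. -/
def centralRepresentation (G : Type) [Group G] (χ : Subgroup.center G →* ℂˣ) :
    Representation ℂ G (centralFunctions G χ) where
  toFun g := (LinearMap.funLeft ℂ ℂ (· * g)).restrict fun f hf z x => by
    simp [LinearMap.funLeft_apply, mul_assoc, hf z]
  map_one' := by ext; simp [LinearMap.funLeft_apply]
  map_mul' g h := by
    ext f x
    exact congrArg f.1 (mul_assoc x g h).symm

theorem centralRepresentation_center {G : Type} [Group G] (χ : Subgroup.center G →* ℂˣ)
    (z : Subgroup.center G) :
    centralRepresentation G χ z = (χ z : ℂ) • LinearMap.id := by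
  ext f x
  have := f.2 z x
  rw [← Subgroup.mem_center_iff.1 z.2 x] at this
  exact this

theorem nontrivial_centralFunctions {G : Type} [Group G] (χ : Subgroup.center G →* ℂˣ) :
    Nontrivial (centralFunctions G χ) := by
  classical
  refine ⟨⟨⟨fun x => if h : x ∈ Subgroup.center G then (χ ⟨x, h⟩ : ℂ) else 0, fun z x => ?_⟩, 0,
    fun h => ?_⟩⟩
  · dsimp only
    by_cases h : x ∈ Subgroup.center G
    · have h' : (z : G) * x ∈ Subgroup.center G := mul_mem z.2 h
      rw [dif_pos h, dif_pos h', ← Units.val_mul, ← map_mul]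
      rfl
    · have h' : ¬ (z : G) * x ∈ Subgroup.center G := fun h' => h <| by
        simpa using mul_mem (inv_mem z.2) h'
      rw [dif_neg h, dif_neg h', mul_zero]
  · have := congrFun (congrArg Subtype.val h) 1
    simp [one_mem] at this

theorem FDRep.injective_of_mono {k G : Type} [Field k] [Group G] {V W : FDRep k G}
    (f : V ⟶ W) [Mono f] :
    Function.Injective f.hom.hom := by
  have : Mono ((Action.forget (FGModuleCat k) G ⋙ forget₂ (FGModuleCat k) (ModuleCat k)).map f) :=
    inferInstance
  exact (ModuleCat.mono_iff_injective _).1 this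

theorem FDRep.isIso_of_bijective {k G : Type} [Field k] [Group G] {V W : FDRep k G} (f : V ⟶ W)
    (hf : Function.Bijective f.hom.hom) : IsIso f := by
  have h : IsIso ((Action.forget (FGModuleCat k) G ⋙ forget₂ (FGModuleCat k) (ModuleCat k)).map f) :=
    (ConcreteCategory.isIso_iff_bijective _).2 hf
  exact isIso_of_reflects_iso f
    (Action.forget (FGModuleCat k) G ⋙ forget₂ (FGModuleCat k) (ModuleCat k))

theorem FDRep.exists_simple_center_smul {G : Type} [Group G] [Finite G]
    (χ : Subgroup.center G →* ℂˣ) :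
    ∃ V : FDRep ℂ G, Simple V ∧ Nontrivial V ∧
      ∀ z : Subgroup.center G, V.ρ z = (χ z : ℂ) • LinearMap.id := by
  let P : ℕ → Prop := fun n => ∃ V : FDRep ℂ G, Module.finrank ℂ V = n ∧ Nontrivial V ∧
      ∀ z : Subgroup.center G, V.ρ z = (χ z : ℂ) • LinearMap.id
  have hP : ∃ n, P n := ⟨_, FDRep.of (centralRepresentation G χ), rfl,
    nontrivial_centralFunctions χ, centralRepresentation_center χ⟩
  classical
  obtain ⟨V, hVn, hV, hz⟩ := Nat.find_spec hP
  refine ⟨V, ⟨fun {Y} f _ => ⟨?_, fun hf => ?_⟩⟩, hV, hz⟩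
  · rintro h rfl
    have h1 : 𝟙 V = 0 := by rw [← IsIso.inv_hom_id (0 : Y ⟶ V), Limits.comp_zero]
    obtain ⟨v, hv⟩ := exists_ne (0 : V)
    exact hv (congrArg (fun φ : V ⟶ V => φ.hom.hom v) h1)
  · have hinj := FDRep.injective_of_mono f
    have hcomm : ∀ (g : G) (y : Y), f.hom.hom (Y.ρ g y) = V.ρ g (f.hom.hom y) := fun g y =>
      congrArg (fun φ : Y.V ⟶ V.V => φ.hom y) (f.comm g)
    have hY : Nontrivial Y := by
      by_contra h
      rw [not_nontrivial_iff_subsingleton] at h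
      refine hf ?_
      ext y
      rw [Subsingleton.elim y 0, map_zero, map_zero]
    have hYz : ∀ z : Subgroup.center G, Y.ρ z = (χ z : ℂ) • LinearMap.id := fun z => by
      ext y
      refine hinj ?_
      rw [hcomm, hz]
      exact (map_smul f.hom.hom.hom (χ z : ℂ) y).symm
    have hle : Module.finrank ℂ V ≤ Module.finrank ℂ Y := by
      rw [hVn]
      exact Nat.find_min' hP ⟨Y, rfl, hY, hYz⟩
    have heq := le_antisymm (LinearMap.finrank_le_finrank_of_injective (f := f.hom.hom.hom) hinj) hle
    exact FDRep.isIso_of_bijective f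
      ⟨hinj, (LinearMap.injective_iff_surjective_of_finrank_eq_finrank heq).1 hinj⟩

open scoped IsMulCommutative in
theorem IsPGroup.exists_family_matrix_representations {G : Type} [Group G] [Finite G] {p : ℕ}
    [Fact p.Prime] (hG : IsPGroup p G) :
    ∃ (ι : Type) (_ : Fintype ι) (k : ι → ℕ) (R : ∀ i, G →* Matrix (Fin (k i)) (Fin (k i)) ℂ),
      Fintype.card ι = minGens (Subgroup.center G) ∧ (∀ i, k i ∈ cdSet G) ∧
      ∀ g, (∀ i, R i g = 1) → g = 1 := by
  obtain ⟨S, hS, hsep⟩ := exists_finset_characters_separating (Subgroup.center G)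
  choose V hV hnt hz using fun χ : S => FDRep.exists_simple_center_smul χ.1
  let R : ∀ χ : S, G →* Matrix (Fin (Module.finrank ℂ (V χ))) (Fin (Module.finrank ℂ (V χ))) ℂ :=
    fun χ => ((LinearMap.toMatrixAlgEquiv
      (Module.finBasis ℂ (V χ))).toAlgHom.toRingHom.toMonoidHom).comp (V χ).ρ
  have hR : ∀ χ g, R χ g = 1 ↔ (V χ).ρ g = 1 := fun χ g =>
    EmbeddingLike.map_eq_one_iff (f := LinearMap.toMatrixAlgEquiv (Module.finBasis ℂ (V χ)))
  refine ⟨S, inferInstance, _, R, by rw [Fintype.card_coe, hS], fun χ => ⟨V χ, hV χ, rfl⟩,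
    fun g hg => ?_⟩
  by_contra hg1
  let N : Subgroup G := ⨅ χ, (R χ).ker
  have hgN : g ∈ N := Subgroup.mem_iInf.2 hg
  have : N.Normal := Subgroup.normal_iInf_normal fun χ => inferInstance
  obtain ⟨z, hzN, hzc, hz1⟩ := hG.exists_mem_center_of_normal N fun h => hg1 <| by
    rwa [h, Subgroup.mem_bot] at hgN
  refine hz1 (congrArg Subtype.val (hsep ⟨z, hzc⟩ fun χ hχ => ?_))
  have h1 := (hR ⟨χ, hχ⟩ z).1 (Subgroup.mem_iInf.1 hzN ⟨χ, hχ⟩)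
  obtain ⟨v, hv⟩ := exists_ne (0 : V ⟨χ, hχ⟩)
  have h2 : (χ ⟨z, hzc⟩ : ℂ) • v = v := by
    have h3 := hz ⟨χ, hχ⟩ ⟨z, hzc⟩
    rw [h1] at h3
    exact (congrArg (fun φ : V ⟨χ, hχ⟩ →ₗ[ℂ] V ⟨χ, hχ⟩ => φ v) h3).symm
  have h4 : ((χ ⟨z, hzc⟩ : ℂ) - 1) • v = 0 := by rw [sub_smul, h2, one_smul, sub_self]
  exact Units.ext (sub_eq_zero.1 ((smul_eq_zero.1 h4).resolve_right hv))

theorem prime_pow_le_of_injective_trace_natCast {G : Type*} [Group G] {p b N : ℕ} (hp : p.Prime)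
    (hexp : Monoid.exponent G = p ^ (b + 1)) (ρ : G →* Matrix.GeneralLinearGroup (Fin N) ℂ)
    (hinj : Function.Injective ρ) (htr : ∀ g : G, ∃ m : ℕ, Matrix.trace (ρ g).val = (m : ℂ)) :
    p ^ (b + 1) ≤ N := by
  obtain ⟨g, hg⟩ : ∃ g : G, g ^ p ^ b ≠ 1 := by
    by_contra! h
    have h1 := Monoid.exponent_dvd_of_forall_pow_eq_one h
    rw [hexp, Nat.pow_dvd_pow_iff_le_right hp.one_lt] at h1
    omega
  have hpow : ∀ k, (ρ g).val ^ k = (ρ (g ^ k)).val := fun k => by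
    rw [map_pow, Units.val_pow_eq_pow_val]
  have h := Matrix.prime_pow_le_card_of_trace_natCast (A := (ρ g).val) hp (b := b)
    (by rw [hpow, ← hexp, Monoid.pow_exponent_eq_one, map_one, Units.val_one])
    (by
      rw [hpow, ← Units.val_one, Ne, Units.val_inj, map_eq_one_iff ρ hinj]
      exact hg)
    (fun k => by rw [hpow]; exact htr _)
  rwa [Fintype.card_fin] at h

theorem sum_Icc_mul_pow_lt_pow {p : ℕ} {a : ℕ → ℕ} (ha : ∀ i, a i < p) (r : ℕ) :
    ∑ i ∈ Finset.Icc 1 r, a i * p ^ i < p ^ (r + 1) := by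
  have hp : 0 < p := (Nat.zero_le _).trans_lt (ha 0)
  induction r with
  | zero => simpa using hp
  | succ r ih =>
    rw [Finset.sum_Icc_succ_top (by omega), pow_succ' p (r + 1)]
    have := Nat.mul_le_mul_right (p ^ (r + 1)) (Nat.succ_le_of_lt (ha (r + 1)))
    rw [Nat.succ_mul] at this
    omega

theorem stmt11 (G : Type) [Group G] [Finite G] (p n b e r : ℕ) (hp : p.Prime)
    (hcard : Nat.card G = p ^ n) (hna : ¬ ∀ x y : G, x * y = y * x)
    (hexp : Monoid.exponent G = p ^ b)
    (hmax : p ^ e ∈ cdSet G ∧ ∀ d ∈ cdSet G, d ≤ p ^ e)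
    (a : ℕ → ℕ) (hai : ∀ i, a i < p) (har : a r ≠ 0)
    (hc : quasiPermDegree G = ∑ i ∈ Finset.Icc 1 r, a i * p ^ i) :
    b ≤ r ∧ (minGens ↥(Subgroup.center G) < p → r ≤ b + e) := by
  have : Fact p.Prime := ⟨hp⟩
  obtain ⟨b, rfl⟩ : ∃ c, b = c + 1 := by
    refine Nat.exists_eq_succ_of_ne_zero ?_
    rintro rfl
    rw [pow_zero, Monoid.exp_eq_one_iff] at hexp
    exact hna fun x y => Subsingleton.elim _ _
  obtain ⟨ι, _, k, R, hι, hk, hR⟩ :=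
    (IsPGroup.of_card hcard).exists_family_matrix_representations
  have hmem := exists_injective_generalLinearGroup_trace_natCast (b := b) hp
    (fun g => by rw [← hexp, Monoid.pow_exponent_eq_one]) k R hR
  constructor
  · obtain ⟨ρ, hinj, htr⟩ := Nat.sInf_mem (Set.nonempty_of_mem (s := {n | ∃ ρ : G →*
      Matrix.GeneralLinearGroup (Fin n) ℂ, Function.Injective ρ ∧ ∀ g : G, ∃ m : ℕ,
        Matrix.trace (ρ g).val = (m : ℂ)}) hmem)
    have h1 : p ^ (b + 1) ≤ quasiPermDegree G :=
      prime_pow_le_of_injective_trace_natCast hp hexp ρ hinj htr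
    have h2 := h1.trans_lt (hc ▸ sum_Icc_mul_pow_lt_pow hai r)
    have := (Nat.pow_lt_pow_iff_right hp.one_lt).1 h2
    omega
  · intro hd
    rcases Nat.eq_zero_or_pos r with rfl | hr
    · omega
    have hle : quasiPermDegree G ≤ (∑ i, k i) * p ^ (b + 1) := Nat.sInf_le hmem
    have hsum : ∑ i, k i ≤ minGens (Subgroup.center G) * p ^ e := by
      rw [← hι]
      exact Finset.sum_le_card_nsmul _ _ _ fun i _ => hmax.2 _ (hk i)
    have hlow : p ^ r ≤ quasiPermDegree G := by
      rw [hc]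
      refine le_trans ?_ (Finset.single_le_sum (f := fun i => a i * p ^ i)
        (fun _ _ => Nat.zero_le _) (Finset.mem_Icc.2 ⟨hr, le_rfl⟩))
      exact Nat.le_mul_of_pos_left _ (Nat.pos_of_ne_zero har)
    have hlt : p ^ r < p ^ (b + 1 + e + 1) := by
      calc p ^ r ≤ (∑ i, k i) * p ^ (b + 1) := hlow.trans hle
        _ ≤ minGens (Subgroup.center G) * p ^ e * p ^ (b + 1) := Nat.mul_le_mul_right _ hsum
        _ < p * p ^ e * p ^ (b + 1) := by
          have h1 := pow_pos hp.pos e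
          have h2 := pow_pos hp.pos (b + 1)
          gcongr
        _ = p ^ (b + 1 + e + 1) := by ring
    have := (Nat.pow_lt_pow_iff_right hp.one_lt).1 hlt
    omega
end

section
/- Let G be a normally monomial finite p-group with cyclic center such that exp(G) = p and max cd(G) = p^a. Then c(G) = p^{a+1}. -/
open FDRep CategoryTheory Subgroup

/-- The character of `G` induced from the class function `f` on the subgroup `H`. -/
noncomputable def indChar {G : Type} [Group G] [Fintype G] (H : Subgroup G) (f : H → ℂ)
    (g : G) : ℂ := by
  classical
  exact (Nat.card H : ℂ)⁻¹ * ∑ x : G, if h : x * g * x⁻¹ ∈ H then f ⟨x * g * x⁻¹, h⟩ else 0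

/-- `G` is normally monomial: every irreducible complex character of `G` is induced
from a linear character of a normal subgroup. -/
def NormallyMonomial (G : Type) [Group G] [Fintype G] : Prop :=
  ∀ V : FDRep ℂ G, Simple V → ∃ N : Subgroup G, N.Normal ∧
    ∃ φ : N →* ℂˣ, ∀ g : G, V.character g = indChar N (fun h => (φ h : ℂ)) g


/-- Every nonzero finite-dimensional representation has an irreducible subrepresentation. -/
theorem Representation.exists_irreducible_subrepresentation {H W : Type*} [Group H]
    [AddCommGroup W] [Module ℂ W] [FiniteDimensional ℂ W] [Nontrivial W]
    (σ : Representation ℂ H W) :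
    ∃ S : Subrepresentation σ, S.toRepresentation.IsIrreducible := by
  obtain ⟨U, ⟨hU, hinv⟩, hmin⟩ := (wellFounded_lt (α := Submodule ℂ W)).has_min
    {U | U ≠ ⊥ ∧ ∀ g, ∀ v ∈ U, σ g v ∈ U} ⟨⊤, top_ne_bot, by simp⟩
  refine ⟨⟨U, fun g v hv => hinv g v hv⟩, ?_⟩
  have hU' : Nontrivial U := Submodule.nontrivial_iff_ne_bot.2 hU
  refine { exists_pair_ne := ⟨⊥, ⊤, fun h => ?_⟩, eq_bot_or_eq_top := fun T => ?_ }
  · exact bot_ne_top (α := Submodule ℂ U) (congrArg Subrepresentation.toSubmodule h)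
  · rw [or_iff_not_imp_left]
    intro hT
    have hT' : T.toSubmodule ≠ ⊥ := fun h =>
      hT (Subrepresentation.toSubmodule_injective h)
    have hmap := hmin (T.toSubmodule.map U.subtype) ⟨?_, ?_⟩
    · have hle : T.toSubmodule.map U.subtype ≤ U := Submodule.map_subtype_le _ _
      have heq := eq_of_le_of_not_lt hle hmap
      apply Subrepresentation.toSubmodule_injective
      apply Submodule.map_injective_of_injective U.injective_subtype
      rw [heq]
      exact (Submodule.map_subtype_top U).symm
    · intro h
      exact hT' (Submodule.map_injective_of_injective U.injective_subtype
        (h.trans (Submodule.map_bot _).symm))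
    · rintro g _ ⟨x, hx, rfl⟩
      exact ⟨_, T.apply_mem_toSubmodule g hx, rfl⟩

/-- The bundled form of an irreducible complex representation is a simple object. -/
theorem FDRep.simple_of_isIrreducible {G W : Type} [Group G] [Finite G]
    [AddCommGroup W] [Module ℂ W] [FiniteDimensional ℂ W] (σ : Representation ℂ G W)
    (hσ : σ.IsIrreducible) : Simple (FDRep.of σ) := by
  have : NeZero (Nat.card G : ℂ) := ⟨by exact_mod_cast Nat.card_pos.ne'⟩
  rw [FDRep.simple_iff_end_is_rank_one]
  let e : (FDRep.of σ ⟶ FDRep.of σ) ≃ₗ[ℂ] Representation.IntertwiningMap σ σ :=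
    { toFun := fun f => ⟨f.hom.hom.hom, fun g => by
        have := f.comm g
        ext x
        exact ConcreteCategory.congr_hom this x⟩
      invFun := fun f => ⟨InducedCategory.homMk (ModuleCat.ofHom f.toLinearMap), fun g => by
        ext1
        ext1
        exact LinearMap.congr_fun (f.isIntertwining' g) _⟩
      map_add' := fun _ _ => rfl
      map_smul' := fun _ _ => rfl
      left_inv := fun _ => rfl
      right_inv := fun _ => rfl }
  rw [e.finrank_eq]
  exact Representation.IsIrreducible.finrank_intertwiningMap_self σ

/-- A nonzero invariant subspace of a simple representation is everything. -/
theorem FDRep.eq_top_of_invariant {G : Type} [Group G] (V : FDRep ℂ G) [Simple V]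
    (U : Submodule ℂ V) (hU : U ≠ ⊥) (hinv : ∀ g, ∀ v ∈ U, V.ρ g v ∈ U) : U = ⊤ := by
  let S : Subrepresentation (show Representation ℂ G V from V.ρ) := ⟨U, fun g v hv => hinv g v hv⟩
  let f : FDRep.of S.toRepresentation ⟶ V :=
    ⟨InducedCategory.homMk (ModuleCat.ofHom U.subtype), fun g => by
      ext1
      ext1
      rfl⟩
  have hm : Mono f := ⟨fun {X} a b hab => by
    ext x
    have := congrArg (fun t => t.hom.hom.hom x) hab
    exact this⟩
  have hf : f ≠ 0 := by
    intro h
    obtain ⟨u, hu, hu0⟩ := U.ne_bot_iff.1 hU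
    have := congrArg (fun t => t.hom.hom.hom (⟨u, hu⟩ : U)) h
    exact hu0 this
  have hi : IsIso f := isIso_of_mono_of_nonzero hf
  rw [eq_top_iff]
  intro v _
  have := congrArg (fun t => t.hom.hom.hom v) (IsIso.inv_hom_id f)
  have h2 : ((inv f).hom.hom.hom v : U).1 = v := this
  rw [← h2]
  exact ((inv f).hom.hom.hom v : U).2

/-- If `N` is an abelian subgroup of `G`, irreducible degrees are at most `|G : N|`. -/
theorem FDRep.finrank_le_index {G : Type} [Group G] [Finite G] (V : FDRep ℂ G) [Simple V]
    (N : Subgroup G) [IsMulCommutative N] : Module.finrank ℂ V ≤ N.index := by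
  have hV : Nontrivial V := by
    by_contra h
    rw [not_nontrivial_iff_subsingleton] at h
    apply id_nonzero V
    ext x
    exact Subsingleton.elim _ _
  let σ : Representation ℂ N V := V.ρ.comp N.subtype
  obtain ⟨S, hS⟩ := σ.exists_irreducible_subrepresentation
  have h1 := Representation.IsIrreducible.finrank_eq_one_of_isMulCommutative S.toRepresentation
  obtain ⟨⟨v, hvS⟩, hv0, hv⟩ := finrank_eq_one_iff'.1 h1
  have hscal : ∀ n : N, ∃ c : ℂ, V.ρ n v = c • v := fun n => by
    obtain ⟨c, hc⟩ := hv ⟨V.ρ n v, S.apply_mem_toSubmodule n hvS⟩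
    exact ⟨c, (congrArg Subtype.val hc).symm⟩
  have : Fintype (G ⧸ N) := Fintype.ofFinite _
  let w : G ⧸ N → V := fun q => V.ρ q.out v
  have hmem : ∀ g : G, V.ρ g v ∈ Submodule.span ℂ (Set.range w) := fun g => by
    obtain ⟨n, hn⟩ := QuotientGroup.mk_out_eq_mul N g
    obtain ⟨c, hc⟩ := hscal n⁻¹
    have : V.ρ g v = c • w g := by
      have hg : g = (g : G ⧸ N).out * (n⁻¹ : N) := by simp [hn]
      conv_lhs => rw [hg, map_mul]
      rw [Module.End.mul_apply, hc, map_smul]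
    rw [this]
    exact Submodule.smul_mem _ _ (Submodule.subset_span ⟨_, rfl⟩)
  have htop : Submodule.span ℂ (Set.range w) = ⊤ := by
    apply V.eq_top_of_invariant
    · intro h
      have := hmem 1
      rw [h, Submodule.mem_bot, map_one] at this
      exact hv0 (Subtype.ext this)
    · intro g x hx
      induction hx using Submodule.span_induction with
      | mem x hx =>
        obtain ⟨q, rfl⟩ := hx
        have := hmem (g * q.out)
        rwa [map_mul] at this
      | zero => simp
      | add x y _ _ hx hy => rw [map_add]; exact add_mem hx hy
      | smul c x _ hx => rw [map_smul]; exact Submodule.smul_mem _ _ hx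
  rw [← finrank_top, ← htop, Subgroup.index, Nat.card_eq_fintype_card]
  exact finrank_range_le_card w

/-- The value of an induced linear character at a central element of its kernel. -/
theorem indChar_eq_index {G : Type} [Group G] [Fintype G] (N : Subgroup G) (φ : N →* ℂˣ)
    (z : N) (hz : (z : G) ∈ Subgroup.center G) (hφ : φ z = 1) :
    indChar N (fun h => (φ h : ℂ)) z = N.index := by
  have hc : ∀ x : G, x * z * x⁻¹ = z := fun x => by
    rw [Subgroup.mem_center_iff.1 hz x, mul_inv_cancel_right]
  have h0 : (Nat.card N : ℂ) ≠ 0 := by exact_mod_cast Nat.card_pos.ne'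
  have hcard : (Nat.card N : ℂ) * N.index = Fintype.card G := by
    rw [← Nat.card_eq_fintype_card]
    exact_mod_cast N.card_mul_index
  unfold indChar
  simp only [hc, SetLike.coe_mem, dite_true, Subtype.coe_eta, hφ]
  simp [← hcard, h0]

/-- If a central element `z` acting by a nontrivial scalar lies in every nontrivial normal
subgroup, then any irreducible constituent is induced from an abelian normal subgroup whose
index is the maximal irreducible degree. -/
theorem NormallyMonomial.exists_abelian_normal {G W : Type} [Group G] [Fintype G]
    (hnm : NormallyMonomial G) {z : G} (hz : z ∈ Subgroup.center G)
    (hzK : ∀ K : Subgroup G, K.Normal → K ≠ ⊥ → z ∈ K)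
    [AddCommGroup W] [Module ℂ W] [FiniteDimensional ℂ W] [Nontrivial W]
    (σ : Representation ℂ G W) {ω : ℂ} (hω : ω ≠ 1) (hσ : ∀ w, σ z w = ω • w) :
    ∃ (N : Subgroup G) (φ : N →* ℂˣ),
      (∀ K : Subgroup G, K.Normal → K ≤ φ.ker.map N.subtype → K = ⊥) ∧
      (∀ d ∈ cdSet G, d ≤ N.index) ∧ N.index ∈ cdSet G ∧ N.index ≤ Module.finrank ℂ W := by
  obtain ⟨S, hS⟩ := σ.exists_irreducible_subrepresentation
  have hsimple := FDRep.simple_of_isIrreducible S.toRepresentation hS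
  obtain ⟨N, hN, φ, hφ⟩ := hnm _ hsimple
  have hdeg : Module.finrank ℂ S.toSubmodule = N.index := by
    have h1 := hφ 1
    rw [FDRep.char_one] at h1
    have h2 := indChar_eq_index N φ 1 (Subgroup.one_mem _) (map_one φ)
    exact_mod_cast h1.trans h2
  have hker : ∀ K : Subgroup G, K.Normal → K ≤ φ.ker.map N.subtype → K = ⊥ := by
    intro K hK hle
    by_contra hne
    obtain ⟨n, hn, rfl⟩ := hle (hzK K hK hne)
    have h1 := hφ n
    rw [indChar_eq_index N φ n hz hn, ← hdeg] at h1
    have h2 : (FDRep.of S.toRepresentation).character n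
        = ω * Module.finrank ℂ S.toSubmodule := by
      have : S.toRepresentation n = ω • LinearMap.id := by
        ext w
        exact hσ w
      change LinearMap.trace ℂ _ (S.toRepresentation n) = _
      rw [this, map_smul, LinearMap.trace_id, smul_eq_mul]
    rw [h2] at h1
    have h3 : (Module.finrank ℂ S.toSubmodule : ℂ) ≠ 0 := by
      rw [hdeg]
      exact_mod_cast Subgroup.index_ne_zero_of_finite
    exact hω (mul_eq_right₀ h3 |>.1 h1)
  have hcomm : IsMulCommutative N := by
    have hbot : (commutator N).map N.subtype = ⊥ := by
      apply hker
      · infer_instance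
      · exact Subgroup.map_mono (Abelianization.commutator_subset_ker φ)
    rw [(Subgroup.map_eq_bot_iff_of_injective _ N.subtype_injective)] at hbot
    exact (commutator_eq_bot_iff N).1 hbot
  refine ⟨N, φ, hker, ?_, ⟨_, hsimple, hdeg⟩, hdeg ▸ Submodule.finrank_le _⟩
  rintro d ⟨V, hV, rfl⟩
  exact V.finrank_le_index N

/-- In a nontrivial `p`-group of exponent `p` with cyclic center, some central element of
order `p` lies in every nontrivial normal subgroup. -/
theorem IsPGroup.exists_mem_center_forall_mem_normal {G : Type*} [Group G] [Finite G] {p : ℕ}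
    [Fact p.Prime] (hG : IsPGroup p G) (hc : IsCyclic (Subgroup.center G))
    (hexp : Monoid.exponent G = p) :
    ∃ z ∈ Subgroup.center G, z ≠ 1 ∧ ∀ K : Subgroup G, K.Normal → K ≠ ⊥ → z ∈ K := by
  have hp : p.Prime := Fact.out
  have hnt : Nontrivial G := by
    by_contra h
    rw [not_nontrivial_iff_subsingleton] at h
    exact hp.ne_one (hexp ▸ Monoid.exp_eq_one_of_subsingleton)
  have hZ := hG.center_nontrivial
  obtain ⟨⟨z, hz⟩, hz1⟩ := exists_ne (1 : Subgroup.center G)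
  refine ⟨z, hz, fun h => hz1 (Subtype.ext h), fun K hK hne => ?_⟩
  have hZcard : Nat.card (Subgroup.center G) = p := by
    rw [← IsCyclic.exponent_eq_card]
    have h1 : Monoid.exponent (Subgroup.center G) ∣ p := by
      rw [← hexp]
      exact Monoid.exponent_dvd_of_monoidHom (Subgroup.center G).subtype
        (Subgroup.center G).subtype_injective
    refine (hp.eq_one_or_self_of_dvd _ h1).resolve_left fun h => ?_
    rw [Monoid.exp_eq_one_iff] at h
    exact not_subsingleton _ h
  have hKnt : Nontrivial K := (Subgroup.nontrivial_iff_ne_bot K).2 hne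
  have hdvd : p ∣ Nat.card K := by
    obtain ⟨m, hm0, hm⟩ := (hG.to_subgroup K).nontrivial_iff_card.mp hKnt
    exact hm.symm ▸ dvd_pow_self _ hm0.ne'
  obtain ⟨b, hb, hb1⟩ :=
    (hG.of_equiv ConjAct.toConjAct).exists_fixed_point_of_prime_dvd_card_of_fixed_point
      K hdvd (a := 1) (fun g => smul_one g)
  have hbZ : (b : G) ∈ Subgroup.center G := by
    rw [Subgroup.mem_center_iff]
    intro g
    have := congrArg Subtype.val (hb (ConjAct.toConjAct g))
    rw [ConjAct.Subgroup.val_conj_smul, ConjAct.toConjAct_smul] at this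
    exact mul_inv_eq_iff_eq_mul.1 this
  have hle : K.subgroupOf (Subgroup.center G) = ⊤ := by
    have : Fact (Nat.card (Subgroup.center G)).Prime := ⟨hZcard ▸ hp⟩
    refine ((K.subgroupOf (Subgroup.center G)).eq_bot_or_eq_top_of_prime_card).resolve_left
      fun h => hb1 ?_
    have : (⟨b, hbZ⟩ : Subgroup.center G) ∈ K.subgroupOf (Subgroup.center G) := b.2
    rw [h, Subgroup.mem_bot] at this
    exact Subtype.ext (congrArg Subtype.val this).symm
  exact Subgroup.subgroupOf_eq_top.1 hle hz

/-- A faithful permutation representation is a faithful quasi-permutation representation. -/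
theorem exists_quasiPerm_of_perm {G : Type*} [Group G] {n : ℕ} (f : G →* Equiv.Perm (Fin n))
    (hf : Function.Injective f) :
    ∃ ρ : G →* Matrix.GeneralLinearGroup (Fin n) ℂ, Function.Injective ρ ∧
      ∀ g : G, ∃ m : ℕ, Matrix.trace ((ρ g : Matrix (Fin n) (Fin n) ℂ)) = (m : ℂ) := by
  let ρ : G →* Matrix.GeneralLinearGroup (Fin n) ℂ :=
    ((Matrix.permMatrixHom (n := Fin n) (R := ℂ)).comp f).toHomUnits
  have hρ : ∀ g, (ρ g : Matrix (Fin n) (Fin n) ℂ) = (f g)⁻¹.permMatrix ℂ := fun _ => rfl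
  refine ⟨ρ, fun g h hgh => hf (inv_injective (Equiv.ext fun i => ?_)), fun g => ?_⟩
  · have h1 : (f g)⁻¹.permMatrix ℂ = (f h)⁻¹.permMatrix ℂ := by rw [← hρ, ← hρ, hgh]
    have h2 := congrFun (congrFun h1 i) ((f g)⁻¹ i)
    simp only [Equiv.Perm.permMatrix, PEquiv.toMatrix_apply, Equiv.toPEquiv_apply,
      Option.mem_def, if_true] at h2
    by_contra hne
    rw [if_neg] at h2
    · exact one_ne_zero h2
    · exact fun h => hne (Option.some_injective _ h).symm
  · exact ⟨_, by rw [hρ, Matrix.trace_permutation]⟩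

/-- The permutation action on the cosets of a core-free subgroup gives a faithful
quasi-permutation representation. -/
theorem exists_quasiPerm_of_normalCore_eq_bot {G : Type*} [Group G] [Finite G] (K : Subgroup G)
    (hK : K.normalCore = ⊥) :
    ∃ ρ : G →* Matrix.GeneralLinearGroup (Fin K.index) ℂ, Function.Injective ρ ∧
      ∀ g : G, ∃ m : ℕ,
        Matrix.trace ((ρ g : Matrix (Fin K.index) (Fin K.index) ℂ)) = (m : ℂ) := by
  have e : G ⧸ K ≃ Fin K.index := Finite.equivFin _
  apply exists_quasiPerm_of_perm (e.permCongrHom.toMonoidHom.comp (MulAction.toPermHom G (G ⧸ K)))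
  apply e.permCongrHom.injective.comp
  rw [← MonoidHom.ker_eq_bot_iff, ← Subgroup.normalCore_eq_ker, hK]

/-- An integral relation `∑ dᵢ ζⁱ = m` at a primitive `p`-th root of unity has constant
coefficients `dᵢ` away from `i = 0`, and `d₀` exceeds them by `m`. -/
theorem IsPrimitiveRoot.coeff_eq_of_sum_eq {p : ℕ} (hp : p.Prime) {ζ : ℂ}
    (hζ : IsPrimitiveRoot ζ p) (d : ℕ → ℕ) (m : ℕ)
    (h : ∑ i ∈ Finset.range p, (d i : ℂ) * ζ ^ i = m) :
    ∃ c : ℕ, d 0 = c + m ∧ ∀ i, i ≠ 0 → i < p → d i = c := by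
  open Polynomial in
  have hfact : Fact p.Prime := ⟨hp⟩
  let q : ℚ[X] := ∑ i ∈ Finset.range p, C (d i : ℚ) * X ^ i - C (m : ℚ)
  have hcoeff : ∀ i, i < p → q.coeff i = d i - if i = 0 then (m : ℚ) else 0 := fun i hi => by
    simp only [q, coeff_sub, finsetSum_coeff, coeff_C_mul, coeff_X_pow, coeff_C]
    simp [hi]
  have hq : aeval ζ q = 0 := by
    simp [q, h]
  have hdvd : cyclotomic p ℚ ∣ q := by
    rw [cyclotomic_eq_minpoly_rat hζ hp.pos]
    exact minpoly.dvd _ _ hq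
  obtain ⟨r, hr⟩ := hdvd
  have hdeg : q.degree < p := by
    apply (degree_sub_le _ _).trans_lt
    rw [max_lt_iff]
    constructor
    · apply (degree_sum_le _ _).trans_lt
      rw [Finset.sup_lt_iff (by simp)]
      intro i hi
      exact (degree_C_mul_X_pow_le _ _).trans_lt (by exact_mod_cast Finset.mem_range.1 hi)
    · exact degree_C_le.trans_lt (by exact_mod_cast hp.pos)
  have hr0 : ∃ c, r = C c := by
    by_cases hr0 : r = 0
    · exact ⟨0, by simp [hr0]⟩
    refine ⟨_, eq_C_of_natDegree_eq_zero ?_⟩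
    have hne : q ≠ 0 := by rw [hr]; exact mul_ne_zero (cyclotomic_ne_zero _ _) hr0
    have h1 := (natDegree_lt_iff_degree_lt hne).2 hdeg
    rw [hr, natDegree_mul (cyclotomic_ne_zero _ _) hr0, natDegree_cyclotomic,
      Nat.totient_prime hp] at h1
    have := hp.one_lt
    omega
  obtain ⟨c, rfl⟩ := hr0
  have hc : ∀ i, i < p → q.coeff i = c := fun i hi => by
    rw [hr, cyclotomic_prime, coeff_mul_C, finsetSum_coeff]
    simp [coeff_X_pow, hi]
  have h1 := (hcoeff 1 hp.one_lt).symm.trans (hc 1 hp.one_lt)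
  have h0 := (hcoeff 0 hp.pos).symm.trans (hc 0 hp.pos)
  simp only [one_ne_zero, if_false, if_true, sub_zero] at h1 h0
  refine ⟨d 1, ?_, fun i hi0 hi => ?_⟩
  · rw [← h1] at h0
    have : (d 0 : ℚ) = d 1 + m := by linarith
    exact_mod_cast this
  · have h2 := (hcoeff i hi).symm.trans (hc i hi)
    rw [if_neg hi0, sub_zero, ← h1] at h2
    exact_mod_cast h2

/-- An endomorphism with `T ^ p = 1` decomposes into the eigenspaces of the powers of a
primitive `p`-th root of unity. -/
theorem Module.End.isInternal_eigenspace_of_pow_eq_one {W : Type*} [AddCommGroup W] [Module ℂ W]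
    [FiniteDimensional ℂ W] {p : ℕ} (hp : 0 < p) {ζ : ℂ} (hζ : IsPrimitiveRoot ζ p)
    (T : Module.End ℂ W) (hT : T ^ p = 1) :
    DirectSum.IsInternal fun i : Fin p => T.eigenspace (ζ ^ (i : ℕ)) := by
  apply DirectSum.isInternal_submodule_of_iSupIndep_of_iSup_eq_top
  · refine T.eigenspaces_iSupIndep.comp (f := fun i : Fin p => ζ ^ (i : ℕ)) fun i j hij => ?_
    exact Fin.ext (hζ.pow_inj i.2 j.2 hij)
  · have hss : T.IsSemisimple := by
      apply Module.End.isSemisimple_of_squarefree_aeval_eq_zero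
        (p := (Polynomial.X ^ p - 1 : Polynomial ℂ))
      · exact ((Polynomial.separable_X_pow_sub_C (1 : ℂ)
          (by exact_mod_cast hp.ne') one_ne_zero).squarefree)
      · simp [hT]
    rw [eq_top_iff, ← hss.iSup_eigenspace_eq_top]
    refine iSup_le fun μ => ?_
    by_cases hμ : T.HasEigenvalue μ
    · obtain ⟨v, hv⟩ := hμ.exists_hasEigenvector
      have h1 : μ ^ p = 1 := by
        have h2 := hv.pow_apply p
        rw [hT, Module.End.one_apply] at h2
        have h3 : (μ ^ p - 1) • v = 0 := by rw [sub_smul, ← h2, one_smul, sub_self]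
        exact sub_eq_zero.1 ((smul_eq_zero.1 h3).resolve_right hv.2)
      have : NeZero p := ⟨hp.ne'⟩
      obtain ⟨i, hi, rfl⟩ := hζ.eq_pow_of_pow_eq_one h1
      exact le_iSup (fun i : Fin p => T.eigenspace (ζ ^ (i : ℕ))) ⟨i, hi⟩
    · rw [Module.End.hasEigenvalue_iff, not_not] at hμ
      rw [hμ]
      exact bot_le

/-- If `T ^ p = 1`, `T ≠ 1` and the trace of `T` is a non-negative integer, then `T` has a
non-trivial eigenspace for an eigenvalue `ω ≠ 1`, and `p` times its dimension is at most the
dimension of the whole space. -/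
theorem Module.End.exists_eigenspace_of_trace_eq_natCast {W : Type*} [AddCommGroup W]
    [Module ℂ W] [FiniteDimensional ℂ W] {p : ℕ} (hp : p.Prime)
    (T : Module.End ℂ W) (hT : T ^ p = 1) (hT1 : T ≠ 1) (m : ℕ)
    (htr : LinearMap.trace ℂ W T = m) :
    ∃ ω : ℂ, ω ≠ 1 ∧ T.eigenspace ω ≠ ⊥ ∧
      p * Module.finrank ℂ (T.eigenspace ω) ≤ Module.finrank ℂ W := by
  have hζ := Complex.isPrimitiveRoot_exp p hp.ne_zero
  set ζ := Complex.exp (2 * Real.pi * Complex.I / p)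
  have hint := T.isInternal_eigenspace_of_pow_eq_one hp.pos hζ hT
  let d : ℕ → ℕ := fun i => Module.finrank ℂ (T.eigenspace (ζ ^ i))
  have hmaps : ∀ i : Fin p, Set.MapsTo T (T.eigenspace (ζ ^ (i : ℕ))) (T.eigenspace (ζ ^ (i : ℕ))) :=
    fun i => T.mapsTo_genEigenspace_of_comm (Commute.refl T) _ _
  have hsum : ∑ i ∈ Finset.range p, (d i : ℂ) * ζ ^ i = m := by
    rw [← htr, LinearMap.trace_eq_sum_trace_restrict hint hmaps, Finset.sum_range]
    refine Finset.sum_congr rfl fun i _ => ?_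
    have : T.restrict (hmaps i) = (ζ ^ (i : ℕ)) • LinearMap.id := by
      ext x
      exact Module.End.mem_eigenspace_iff.1 x.2
    rw [this, map_smul, LinearMap.trace_id, smul_eq_mul, mul_comm]
  obtain ⟨c, hc0, hc⟩ := hζ.coeff_eq_of_sum_eq hp d m hsum
  have hdim : Module.finrank ℂ W = ∑ i : Fin p, d i := by
    rw [← (LinearEquiv.ofBijective (DirectSum.coeLinearMap _) hint).finrank_eq, Module.finrank_directSum]
  have hle : p * c ≤ Module.finrank ℂ W := by
    rw [hdim]
    conv_lhs => rw [← Finset.card_fin p, ← smul_eq_mul]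
    refine Finset.card_nsmul_le_sum _ _ _ fun i _ => ?_
    by_cases hi : (i : ℕ) = 0
    · rw [hi, hc0]; exact Nat.le_add_right _ _
    · exact (hc i hi i.2).ge
  obtain ⟨i, hi0, hi⟩ : ∃ i : Fin p, (i : ℕ) ≠ 0 ∧ T.eigenspace (ζ ^ (i : ℕ)) ≠ ⊥ := by
    by_contra! hall
    apply hT1
    have htop : T.eigenspace 1 = ⊤ := by
      rw [eq_top_iff, ← hint.submodule_iSup_eq_top]
      refine iSup_le fun i => ?_
      by_cases hi : (i : ℕ) = 0
      · rw [hi, pow_zero]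
      · rw [hall i hi]; exact bot_le
    ext w
    have hw : w ∈ T.eigenspace 1 := htop ▸ Submodule.mem_top
    rw [Module.End.mem_eigenspace_iff.1 hw, one_smul, Module.End.one_apply]
  refine ⟨ζ ^ (i : ℕ), hζ.pow_ne_one_of_pos_of_lt hi0 i.2, hi, ?_⟩
  have : Module.finrank ℂ (T.eigenspace (ζ ^ (i : ℕ))) = c := hc i hi0 i.2
  rwa [this]

/-- The degree of a faithful quasi-permutation representation is at least `p` times the maximal
irreducible degree, which is the index of an abelian normal subgroup carrying a linear character
with core-free kernel. -/
theorem NormallyMonomial.exists_index_le_of_quasiPerm {G : Type} [Group G] [Fintype G]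
    (hnm : NormallyMonomial G) {p n : ℕ} (hp : p.Prime) (hG : IsPGroup p G)
    (hc : IsCyclic (Subgroup.center G)) (hexp : Monoid.exponent G = p)
    (ρ : G →* Matrix.GeneralLinearGroup (Fin n) ℂ) (hρ : Function.Injective ρ)
    (htr : ∀ g : G, ∃ m : ℕ, Matrix.trace ((ρ g : Matrix (Fin n) (Fin n) ℂ)) = (m : ℂ)) :
    ∃ (N : Subgroup G) (φ : N →* ℂˣ), (φ.ker.map N.subtype).normalCore = ⊥ ∧
      N.index = sSup (cdSet G) ∧ p * N.index ≤ n := by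
  have : Fact p.Prime := ⟨hp⟩
  obtain ⟨z, hz, hz1, hzK⟩ := hG.exists_mem_center_forall_mem_normal hc hexp
  let τ : Representation ℂ G (Fin n → ℂ) :=
    (Matrix.toLinAlgEquiv' (R := ℂ) (n := Fin n)).toAlgHom.toMonoidHom.comp
      ((Units.coeHom _).comp ρ)
  have hτ : ∀ g, τ g = Matrix.toLin' (ρ g : Matrix (Fin n) (Fin n) ℂ) := fun _ => rfl
  have hτz : τ z ≠ 1 := fun h => hz1 (hρ (Units.ext (Matrix.toLin'.injective (by
    rw [← hτ, h, map_one, Units.val_one, Matrix.toLin'_one]; rfl))))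
  have hτp : τ z ^ p = 1 := by rw [← map_pow, ← hexp, Monoid.pow_exponent_eq_one, map_one]
  obtain ⟨m, hm⟩ := htr z
  obtain ⟨ω, hω, hne, hle⟩ := Module.End.exists_eigenspace_of_trace_eq_natCast hp (τ z) hτp hτz m
    (by rw [hτ, Matrix.trace_toLin'_eq, hm])
  let S : Subrepresentation τ := ⟨Module.End.eigenspace (τ z) ω, fun g v hv => by
    rw [Module.End.mem_eigenspace_iff] at hv ⊢
    rw [← Module.End.mul_apply, ← map_mul, ← Subgroup.mem_center_iff.1 hz g, map_mul,
      Module.End.mul_apply, hv, map_smul]⟩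
  have : Nontrivial S.toSubmodule := Submodule.nontrivial_iff_ne_bot.2 hne
  obtain ⟨N, φ, hker, hmax, hmem, hNle⟩ := hnm.exists_abelian_normal hz hzK S.toRepresentation hω
    (fun w => Subtype.ext (Module.End.mem_eigenspace_iff.1 w.2))
  refine ⟨N, φ, hker _ inferInstance (Subgroup.normalCore_le _),
    ((IsGreatest.csSup_eq ⟨hmem, hmax⟩)).symm, (Nat.mul_le_mul_left p hNle).trans ?_⟩
  simpa using hle

/-- The image of a linear character of a finite group has order dividing the exponent. -/
theorem MonoidHom.card_range_dvd_exponent {N : Type*} [Group N] [Finite N] (φ : N →* ℂˣ) :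
    Nat.card φ.range ∣ Monoid.exponent N := by
  have : Finite φ.range := Finite.of_surjective _ φ.rangeRestrict_surjective
  have : IsCyclic φ.range := isCyclic_subgroup_units _
  rw [← IsCyclic.exponent_eq_card]
  exact MonoidHom.exponent_dvd φ.rangeRestrict_surjective

theorem stmt14 (G : Type) [Group G] [Fintype G] (p n a : ℕ) (hp : p.Prime)
    (hcard : Nat.card G = p ^ n) (hnm : NormallyMonomial G)
    (hc : IsCyclic (Subgroup.center G)) (hexp : Monoid.exponent G = p)
    (hmaxcd : sSup (cdSet G) = p ^ a) :
    quasiPermDegree G = p ^ (a + 1) := by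
  have hG : IsPGroup p G := IsPGroup.of_card hcard
  have hlow : ∀ k, (∃ ρ : G →* Matrix.GeneralLinearGroup (Fin k) ℂ, Function.Injective ρ ∧
      ∀ g : G, ∃ m : ℕ, Matrix.trace ((ρ g : Matrix (Fin k) (Fin k) ℂ)) = (m : ℂ)) →
      p ^ (a + 1) ≤ k := by
    rintro k ⟨ρ, hρ, htr⟩
    obtain ⟨N, -, -, hN, hle⟩ := hnm.exists_index_le_of_quasiPerm hp hG hc hexp ρ hρ htr
    rwa [hN, hmaxcd, ← pow_succ'] at hle
  obtain ⟨ρ, hρ, htr⟩ := exists_quasiPerm_of_normalCore_eq_bot (⊥ : Subgroup G)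
    (le_bot_iff.1 (Subgroup.normalCore_le _))
  obtain ⟨N, φ, hcore, hN, -⟩ := hnm.exists_index_le_of_quasiPerm hp hG hc hexp ρ hρ htr
  have hK := exists_quasiPerm_of_normalCore_eq_bot _ hcore
  have hKle : (φ.ker.map N.subtype).index ≤ p ^ (a + 1) := by
    rw [Subgroup.index_map_subtype, Subgroup.index_ker, hN, hmaxcd, pow_succ']
    refine Nat.mul_le_mul_right _ (Nat.le_of_dvd hp.pos (φ.card_range_dvd_exponent.trans ?_))
    rw [← hexp]
    exact Monoid.exponent_dvd_of_monoidHom N.subtype N.subtype_injective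
  apply le_antisymm
  · exact (Nat.sInf_le hK).trans hKle
  · exact le_csInf ⟨_, hK⟩ hlow
end
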